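/- arXiv:1406.1144 — 13 statements merged into one kernel-verified Lean document; each statement's English description precedes it below -/
import Mathlib

section
/- Let a, b ∈ ℂ and ρ > 0, and suppose Re(a · conj(b)) = 1 and |a|² + |b|²/ρ ≤ C' for some C' > 0. Then for every θ ∈ ℝ one has |cos(θ)·a + (i/√ρ)·sin(θ)·b|² ≥ 1/(ρ · C'). -/
open Complex

/-- if `Re (a · conj b) = 1` and `|a|² + |b|²/ρ ≤ C'` with `ρ, C' > 0`, then
for every `θ : ℝ`, `|cos θ · a + (i/√ρ)·sin θ · b|² ≥ 1/(ρ·C')`. -/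
theorem stmt3 (a b : ℂ) (ρ : ℝ) (hρ : 0 < ρ) (C' : ℝ) (hC' : 0 < C')
    (hab : (a * (starRingEnd ℂ) b).re = 1)
    (hbound : ‖a‖ ^ 2 + ‖b‖ ^ 2 / ρ ≤ C') :
    ∀ θ : ℝ,
      ‖(Real.cos θ : ℂ) * a + (Complex.I / (Real.sqrt ρ : ℂ)) * (Real.sin θ : ℂ) * b‖ ^ 2 ≥
        1 / (ρ * C') := by
  intro θ
  have h1 := Real.sin_sq_add_cos_sq θ
  obtain ⟨t, ht⟩ : ∃ t : ℝ, t = (Real.sqrt ρ)⁻¹ := ⟨_, rfl⟩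
  have ht2 : t ^ 2 = 1 / ρ := by
    rw [ht, inv_pow, Real.sq_sqrt hρ.le, one_div]
  have hI : Complex.I / (Real.sqrt ρ : ℂ) = Complex.I * (t : ℂ) := by
    rw [ht, Complex.ofReal_inv, div_eq_mul_inv]
  rw [hI]
  rw [div_eq_mul_one_div, ← ht2] at hbound
  generalize Real.sin θ = s at *
  generalize Real.cos θ = c at *
  rw [Complex.sq_norm, Complex.normSq_apply] at hbound ⊢
  rw [Complex.sq_norm, Complex.normSq_apply] at hbound
  obtain ⟨x, y⟩ := a
  obtain ⟨u, v⟩ := b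
  simp at hab hbound ⊢
  have key : t ^ 2 = ((c * x - t * s * v) * (-s * y + t * c * u)
      - (c * y + t * s * u) * (-s * x - t * c * v)) ^ 2 := by
    have : (c * x - t * s * v) * (-s * y + t * c * u)
      - (c * y + t * s * u) * (-s * x - t * c * v) = t * (x * u + y * v) * (s ^ 2 + c ^ 2) := by
      ring
    rw [this, h1, hab]; ring
  have hsum : (c * x - t * s * v) ^ 2 + (c * y + t * s * u) ^ 2
      + ((-s * x - t * c * v) ^ 2 + (-s * y + t * c * u) ^ 2) ≤ C' := by
    have : (c * x - t * s * v) ^ 2 + (c * y + t * s * u) ^ 2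
      + ((-s * x - t * c * v) ^ 2 + (-s * y + t * c * u) ^ 2)
      = (s ^ 2 + c ^ 2) * (x * x + y * y + (u * u + v * v) * t ^ 2) := by ring
    rw [this, h1, one_mul]; exact hbound
  have hz : c * x + -(t * s * v) = c * x - t * s * v := by ring
  rw [hz]
  have hfin : t ^ 2 ≤ ((c * x - t * s * v) ^ 2 + (c * y + t * s * u) ^ 2) * C' := by
    generalize c * x - t * s * v = p at *
    generalize c * y + t * s * u = q at *
    generalize -s * x - t * c * v = p' at *
    generalize -s * y + t * c * u = q' at *
    have h2 : p' ^ 2 + q' ^ 2 ≤ C' := by nlinarith [sq_nonneg p, sq_nonneg q]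
    have h3 := mul_le_mul_of_nonneg_left h2 (by positivity : 0 ≤ p ^ 2 + q ^ 2)
    nlinarith [sq_nonneg (p * p' + q * q')]
  rw [ht2] at hfin
  have h4 : C'⁻¹ * ρ⁻¹ = 1 / ρ / C' := by ring
  rw [h4, div_le_iff₀ hC']
  linarith [hfin]
end

section
/- Let N ≥ 1 and ρ₀, …, ρ_{N−1} > 0. Define, for each β ∈ ℝ, complex numbers D₀(β) = cos(2β/√ρ₀) + (i/√ρ₀)·sin(2β/√ρ₀) and D̃₀(β) = cos(2β/√ρ₀) + i·√ρ₀·sin(2β/√ρ₀), and recursively for 1 ≤ n ≤ N−1: D_n(β) = cos(β/√ρ_n)·D_{n−1}(β) + (i/√ρ_n)·sin(β/√ρ_n)·D̃_{n−1}(β) and D̃_n(β) = i·√ρ_n·sin(β/√ρ_n)·D_{n−1}(β) + cos(β/√ρ_n)·D̃_{n−1}(β). Then Re(D_n(β) · conj(D̃_n(β))) = 1 for all 0 ≤ n ≤ N−1 and all β ∈ ℝ, and there exists a constant γ > 0 (depending only on N and ρ₀, …, ρ_{N−1}) such that |D_{N−1}(β)| ≥ γ for all β ∈ ℝ. -/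
open Complex

lemma aux_re (s t : ℝ) (hs : 0 < s) (a b : ℂ) :
    (((Real.cos t : ℂ) * a + (Complex.I / (s : ℂ)) * (Real.sin t : ℂ) * b) *
      (starRingEnd ℂ) (Complex.I * (s : ℂ) * (Real.sin t : ℂ) * a + (Real.cos t : ℂ) * b)).re
    = (a * (starRingEnd ℂ) b).re := by
  have h := Real.sin_sq_add_cos_sq t
  have e : (Complex.I / (s : ℂ)) = ((s⁻¹ : ℝ) : ℂ) * Complex.I := by
    push_cast; rw [div_eq_mul_inv, mul_comm]
  rw [e]
  generalize Real.cos t = c at *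
  generalize Real.sin t = S at *
  have hi : s⁻¹ * s = 1 := inv_mul_cancel₀ hs.ne'
  generalize s⁻¹ = r at *
  simp
  linear_combination (a.re * b.re + a.im * b.im) * h + S ^ 2 * (a.re * b.re + a.im * b.im) * hi

lemma aux_bd (s t : ℝ) (hs : 0 < s) (a b : ℂ) (M : ℝ) (ha : ‖a‖ ≤ M) (hb : ‖b‖ ≤ M) :
    ‖(Real.cos t : ℂ) * a + (Complex.I / (s : ℂ)) * (Real.sin t : ℂ) * b‖ ≤ (1 + s + s⁻¹) * M ∧
    ‖Complex.I * (s : ℂ) * (Real.sin t : ℂ) * a + (Real.cos t : ℂ) * b‖ ≤ (1 + s + s⁻¹) * M := by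
  have hc := Real.abs_cos_le_one t
  have hS := Real.abs_sin_le_one t
  have hM : 0 ≤ M := (norm_nonneg a).trans ha
  have hi : 0 < s⁻¹ := inv_pos.mpr hs
  have key : ∀ x : ℂ, ‖x‖ ≤ M → ‖(Real.cos t : ℂ) * x‖ ≤ M := by
    intro x hx
    rw [norm_mul, Complex.norm_real, Real.norm_eq_abs]
    calc _ ≤ 1 * M := by gcongr
      _ = M := one_mul M
  have h2 : ‖(Complex.I / (s : ℂ)) * (Real.sin t : ℂ) * b‖ ≤ s⁻¹ * M := by
    rw [norm_mul, norm_mul, norm_div, Complex.norm_I, Complex.norm_real, Complex.norm_real,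
      Real.norm_eq_abs, Real.norm_eq_abs, abs_of_pos hs, one_div]
    calc _ ≤ s⁻¹ * 1 * M := by gcongr
      _ = _ := by ring
  have h3 : ‖Complex.I * (s : ℂ) * (Real.sin t : ℂ) * a‖ ≤ s * M := by
    rw [norm_mul, norm_mul, norm_mul, Complex.norm_I, Complex.norm_real, Complex.norm_real,
      Real.norm_eq_abs, Real.norm_eq_abs, abs_of_pos hs, one_mul]
    calc _ ≤ s * 1 * M := by gcongr
      _ = _ := by ring
  have p1 := mul_nonneg hs.le hM
  have p2 := mul_nonneg hi.le hM
  constructor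
  · have := norm_add_le ((Real.cos t : ℂ) * a) ((Complex.I / (s : ℂ)) * (Real.sin t : ℂ) * b)
    have := key a ha
    linarith
  · have := norm_add_le (Complex.I * (s : ℂ) * (Real.sin t : ℂ) * a) ((Real.cos t : ℂ) * b)
    have := key b hb
    linarith

/-- for densities `ρ₀, …, ρ_{N−1} > 0`, the determinants defined by
`D₀(β) = cos(2β/√ρ₀) + (i/√ρ₀)·sin(2β/√ρ₀)`, `D̃₀(β) = cos(2β/√ρ₀) + i·√ρ₀·sin(2β/√ρ₀)` and,
for `1 ≤ n ≤ N−1`,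
`D_n(β) = cos(β/√ρ_n)·D_{n−1}(β) + (i/√ρ_n)·sin(β/√ρ_n)·D̃_{n−1}(β)`,
`D̃_n(β) = i·√ρ_n·sin(β/√ρ_n)·D_{n−1}(β) + cos(β/√ρ_n)·D̃_{n−1}(β)`,
satisfy `Re (D_n(β)·conj (D̃_n(β))) = 1` for all `0 ≤ n ≤ N−1`, `β ∈ ℝ`, and there is `γ > 0`
with `|D_{N−1}(β)| ≥ γ` for all `β ∈ ℝ`. -/
theorem stmt4 (N : ℕ) (hN : 1 ≤ N) (ρ : ℕ → ℝ) (hρ : ∀ j < N, 0 < ρ j)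
    (D Dt : ℕ → ℝ → ℂ)
    (hD0 : ∀ β : ℝ, D 0 β = (Real.cos (2 * β / Real.sqrt (ρ 0)) : ℂ) +
      (Complex.I / (Real.sqrt (ρ 0) : ℂ)) * (Real.sin (2 * β / Real.sqrt (ρ 0)) : ℂ))
    (hDt0 : ∀ β : ℝ, Dt 0 β = (Real.cos (2 * β / Real.sqrt (ρ 0)) : ℂ) +
      Complex.I * (Real.sqrt (ρ 0) : ℂ) * (Real.sin (2 * β / Real.sqrt (ρ 0)) : ℂ))
    (hDrec : ∀ n, 1 ≤ n → n ≤ N - 1 → ∀ β : ℝ,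
      D n β = (Real.cos (β / Real.sqrt (ρ n)) : ℂ) * D (n - 1) β +
        (Complex.I / (Real.sqrt (ρ n) : ℂ)) * (Real.sin (β / Real.sqrt (ρ n)) : ℂ) *
          Dt (n - 1) β)
    (hDtrec : ∀ n, 1 ≤ n → n ≤ N - 1 → ∀ β : ℝ,
      Dt n β = Complex.I * (Real.sqrt (ρ n) : ℂ) * (Real.sin (β / Real.sqrt (ρ n)) : ℂ) *
        D (n - 1) β + (Real.cos (β / Real.sqrt (ρ n)) : ℂ) * Dt (n - 1) β) :
    (∀ n ≤ N - 1, ∀ β : ℝ, (D n β * (starRingEnd ℂ) (Dt n β)).re = 1) ∧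
    ∃ γ : ℝ, 0 < γ ∧ ∀ β : ℝ, γ ≤ ‖D (N - 1) β‖ := by
  have main : ∀ n ≤ N - 1, (∀ β : ℝ, (D n β * (starRingEnd ℂ) (Dt n β)).re = 1) ∧
      ∃ M : ℝ, ∀ β : ℝ, ‖D n β‖ ≤ M ∧ ‖Dt n β‖ ≤ M := by
    intro n
    induction n with
    | zero =>
      intro _
      have hs := Real.sqrt_pos.mpr (hρ 0 (by omega))
      have e1 : ∀ β, D 0 β = (Real.cos (2 * β / Real.sqrt (ρ 0)) : ℂ) * 1 +
          (Complex.I / (Real.sqrt (ρ 0) : ℂ)) * (Real.sin (2 * β / Real.sqrt (ρ 0)) : ℂ) * 1 := by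
        intro β; rw [hD0, mul_one, mul_one]
      have e2 : ∀ β, Dt 0 β = Complex.I * (Real.sqrt (ρ 0) : ℂ) *
          (Real.sin (2 * β / Real.sqrt (ρ 0)) : ℂ) * 1 +
          (Real.cos (2 * β / Real.sqrt (ρ 0)) : ℂ) * 1 := by
        intro β; rw [hDt0, mul_one, mul_one, add_comm]
      refine ⟨fun β => ?_, (1 + √(ρ 0) + (√(ρ 0))⁻¹) * 1, fun β => ?_⟩
      · rw [e1, e2, aux_re _ _ hs]; simp
      · rw [e1, e2]
        exact aux_bd _ _ hs 1 1 1 (by simp) (by simp)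
    | succ n ih =>
      intro hn
      obtain ⟨h1, M, hM⟩ := ih (by omega)
      have hs := Real.sqrt_pos.mpr (hρ (n + 1) (by omega))
      refine ⟨fun β => ?_, (1 + √(ρ (n + 1)) + (√(ρ (n + 1)))⁻¹) * M, fun β => ?_⟩
      · rw [hDrec (n + 1) (by omega) hn, hDtrec (n + 1) (by omega) hn, aux_re _ _ hs]
        exact h1 β
      · rw [hDrec (n + 1) (by omega) hn, hDtrec (n + 1) (by omega) hn]
        exact aux_bd _ _ hs _ _ M (hM β).1 (hM β).2
  refine ⟨fun n hn => (main n hn).1, ?_⟩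
  obtain ⟨h1, M, hM⟩ := main (N - 1) le_rfl
  have hb : ∀ β, 1 ≤ ‖D (N - 1) β‖ * M := by
    intro β
    calc 1 = (D (N - 1) β * (starRingEnd ℂ) (Dt (N - 1) β)).re := (h1 β).symm
      _ ≤ ‖D (N - 1) β * (starRingEnd ℂ) (Dt (N - 1) β)‖ := Complex.re_le_norm _
      _ = ‖D (N - 1) β‖ * ‖Dt (N - 1) β‖ := by rw [norm_mul, Complex.norm_conj]
      _ ≤ _ := mul_le_mul_of_nonneg_left (hM β).2 (norm_nonneg _)
  have hMpos : 0 < M := by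
    by_contra hneg
    have := mul_nonneg (norm_nonneg (D (N - 1) 0)) (sub_nonneg.mpr (not_lt.mp hneg))
    have := hb 0
    linarith
  refine ⟨1 / M, by positivity, fun β => ?_⟩
  rw [div_le_iff₀ hMpos]
  exact hb β
end

section
/- Let N ≥ 1, ρ₀, …, ρ_{N−1} > 0 and β ∈ ℝ. Suppose y₀, …, y_{N−1} are functions with y_j : [j, j+1] → ℂ twice continuously differentiable, satisfying ρ_j·y_j''(x) + β²·y_j(x) = 0 on [j, j+1] for each j, together with y₀(0) = 0, y₀'(0) = 0, y_{N−1}(N) = 0, the continuity conditions y_{j−1}(j) = y_j(j) for j = 1, …, N−1, and the flux conditions ρ_{j−1}·y_{j−1}'(j) = ρ_j·y_j'(j) for j = 1, …, N−1. Then y_j ≡ 0 on [j, j+1] for every j = 0, …, N−1. -/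
open Complex Set

theorem aux_ode (a b r β : ℝ) (hr : 0 < r) (u u' u'' : ℝ → ℂ)
    (h1 : ∀ x ∈ Icc a b, HasDerivWithinAt u (u' x) (Icc a b) x)
    (h2 : ∀ x ∈ Icc a b, HasDerivWithinAt u' (u'' x) (Icc a b) x)
    (hode : ∀ x ∈ Icc a b, (r : ℂ) * u'' x + (β : ℂ) ^ 2 * u x = 0)
    (h0 : u a = 0) (h0' : u' a = 0) : ∀ x ∈ Icc a b, u x = 0 ∧ u' x = 0 := by
  have hder : ∀ x ∈ Icc a b,
      HasDerivWithinAt (fun t => (u t, u' t)) (u' x, u'' x) (Icc a b) x :=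
    fun x hx => (h1 x hx).prodMk (h2 x hx)
  have key := eq_zero_of_abs_deriv_le_mul_abs_self_of_eq_zero_right
    (f := fun t => (u t, u' t)) (f' := fun t => (u' t, u'' t)) (K := 1 + β ^ 2 / r)
    (a := a) (b := b) (fun x hx => (hder x hx).continuousWithinAt)
    (fun x hx => (hder x (Ico_subset_Icc_self hx)).mono_of_mem_nhdsWithin
      (Icc_mem_nhdsGE_of_mem hx))
    (by simp [h0, h0'])
    (by
      intro x hx
      have hx' := hode x (Ico_subset_Icc_self hx)
      have hrc : (r : ℂ) ≠ 0 := by exact_mod_cast hr.ne'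
      have e : u'' x = -(((β ^ 2 / r : ℝ) : ℂ) * u x) := by
        push_cast
        field_simp
        linear_combination hx'
      have hc : 0 ≤ β ^ 2 / r := by positivity
      have e2 : ‖u'' x‖ = β ^ 2 / r * ‖u x‖ := by
        rw [e, norm_neg, norm_mul, Complex.norm_real, Real.norm_of_nonneg hc]
      have n1 : ‖u x‖ ≤ ‖(u x, u' x)‖ := norm_fst_le (u x, u' x)
      have n2 : ‖u' x‖ ≤ ‖(u x, u' x)‖ := norm_snd_le (u x, u' x)
      have n0 := norm_nonneg (u x, u' x)
      have m1 := mul_le_mul_of_nonneg_left n1 hc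
      have m0 := mul_nonneg hc n0
      refine norm_prod_le_iff.2 ⟨?_, ?_⟩
      · show ‖u' x‖ ≤ _
        linarith
      · show ‖u'' x‖ ≤ _
        rw [e2]
        linarith)
  intro x hx
  simpa using key x hx

/-- if `y_j : [j, j+1] → ℂ` are C² and satisfy `ρ_j y_j'' + β² y_j = 0`,
`y₀(0) = 0`, `y₀'(0) = 0`, `y_{N−1}(N) = 0`, the continuity conditions `y_{j−1}(j) = y_j(j)`
and the flux conditions `ρ_{j−1} y_{j−1}'(j) = ρ_j y_j'(j)`, then every `y_j` vanishes
identically on `[j, j+1]`.  (The functions `y' j` and `y'' j` are the first and second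
derivatives of `y j` on `[j, j+1]`.) -/
theorem stmt5 (N : ℕ) (hN : 1 ≤ N) (ρ : ℕ → ℝ) (hρ : ∀ j < N, 0 < ρ j) (β : ℝ)
    (y y' y'' : ℕ → ℝ → ℂ)
    (hderiv1 : ∀ j < N, ∀ x ∈ Icc (j : ℝ) (j + 1),
      HasDerivWithinAt (y j) (y' j x) (Icc (j : ℝ) (j + 1)) x)
    (hderiv2 : ∀ j < N, ∀ x ∈ Icc (j : ℝ) (j + 1),
      HasDerivWithinAt (y' j) (y'' j x) (Icc (j : ℝ) (j + 1)) x)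
    (hcont : ∀ j < N, ContinuousOn (y'' j) (Icc (j : ℝ) (j + 1)))
    (hode : ∀ j < N, ∀ x ∈ Icc (j : ℝ) (j + 1),
      (ρ j : ℂ) * y'' j x + (β : ℂ) ^ 2 * y j x = 0)
    (hy0 : y 0 0 = 0) (hy'0 : y' 0 0 = 0)
    (hyN : y (N - 1) N = 0)
    (hcont_node : ∀ j, 1 ≤ j → j ≤ N - 1 → y (j - 1) j = y j j)
    (hflux : ∀ j, 1 ≤ j → j ≤ N - 1 → (ρ (j - 1) : ℂ) * y' (j - 1) j = (ρ j : ℂ) * y' j j) :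
    ∀ j < N, ∀ x ∈ Icc (j : ℝ) (j + 1), y j x = 0 := by
  have main : ∀ j < N, y j j = 0 ∧ y' j j = 0 := by
    intro j
    induction j with
    | zero => intro _; exact ⟨by simpa using hy0, by simpa using hy'0⟩
    | succ j ih =>
      intro hj
      have hj' : j < N := by omega
      obtain ⟨a0, a1⟩ := ih hj'
      obtain ⟨b0, b1⟩ := aux_ode j (j + 1) (ρ j) β (hρ j hj') _ _ _ (hderiv1 j hj')
        (hderiv2 j hj') (hode j hj') a0 a1 (j + 1) ⟨by linarith, le_rfl⟩
      have c0 := hcont_node (j + 1) (by omega) (by omega)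
      have c1 := hflux (j + 1) (by omega) (by omega)
      simp only [Nat.add_sub_cancel] at c0 c1
      have hc : ((j + 1 : ℕ) : ℝ) = j + 1 := by push_cast; rfl
      have hrc : (ρ (j + 1) : ℂ) ≠ 0 := by exact_mod_cast (hρ (j + 1) hj).ne'
      refine ⟨by rw [← c0, hc, b0], ?_⟩
      rw [hc] at c1 ⊢
      rw [b1, mul_zero] at c1
      exact (mul_eq_zero.1 c1.symm).resolve_left hrc
  intro j hj x hx
  exact (aux_ode j (j + 1) (ρ j) β (hρ j hj) _ _ _ (hderiv1 j hj)
    (hderiv2 j hj) (hode j hj) (main j hj).1 (main j hj).2 x hx).1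
end

section
/- Let N ≥ 1 and ρ₀, …, ρ_{N−1} > 0. There exists a constant C > 0, depending only on N and ρ₀, …, ρ_{N−1} (in particular independent of β), with the following property: for every β ∈ ℝ, every family G = (G₀, …, G_{N−1}) of continuous functions G_j : [j, j+1] → ℂ², and every family W = (W₀, …, W_{N−1}) of continuously differentiable functions W_j : [j, j+1] → ℂ² satisfying iβ·W_j(x) − B(ρ_j)·W_j'(x) = G_j(x) on [j, j+1] for each j, the transmission conditions W_{j−1}(j) = W_j(j) for j = 1, …, N−1, the boundary condition that the first component of W₀(0) equals the second component of W₀(0), and the boundary condition that the first component of W_{N−1}(N) equals 0, one has Σ_{j=0}^{N−1} ∫_j^{j+1} ‖W_j(x)‖² dx ≤ C · Σ_{j=0}^{N−1} ∫_j^{j+1} ‖G_j(x)‖² dx. -/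
open Complex Set Matrix

lemma aux_re_s6 (z w : ℂ) : |z.re * w.re + z.im * w.im| ≤ ‖z‖ * ‖w‖ := by
  have h := Complex.abs_re_le_norm (z * (starRingEnd ℂ) w)
  simpa using h

lemma aux_mono {a : ℝ} {f f' q : ℝ → ℝ}
    (hf : ∀ x ∈ Icc a (a + 1), HasDerivWithinAt f (f' x) (Icc a (a + 1)) x)
    (hq : ContinuousOn q (Icc a (a + 1))) (hq0 : ∀ x ∈ Icc a (a + 1), 0 ≤ q x)
    (hle : ∀ x ∈ Icc a (a + 1), f' x ≤ q x) :
    ∀ y ∈ Icc a (a + 1), f y - f a ≤ ∫ x in a..(a + 1), q x := by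
  intro y hy
  have hsub : Icc a y ⊆ Icc a (a + 1) := Icc_subset_Icc_right hy.2
  have h1 : f y - f a ≤ ∫ x in a..y, q x := by
    refine intervalIntegral.sub_le_integral_of_hasDeriv_right_of_le (g' := f') hy.1
      (fun x hx => ((hf x (hsub hx)).continuousWithinAt).mono hsub) ?_
      (hq.mono hsub).integrableOn_Icc ?_
    · intro x hx
      have hx' : x ∈ Ioo a (a + 1) := ⟨hx.1, hx.2.trans_le hy.2⟩
      exact ((hf x (Ioo_subset_Icc_self hx')).hasDerivAt (Icc_mem_nhds hx'.1 hx'.2)).hasDerivWithinAt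
    · intro x hx
      exact hle x (hsub (Ioo_subset_Icc_self hx))
  refine h1.trans ?_
  refine intervalIntegral.integral_mono_interval le_rfl hy.1 hy.2 ?_ ?_
  · filter_upwards [MeasureTheory.ae_restrict_mem measurableSet_Ioc] with x hx
    exact hq0 x (Ioc_subset_Icc_self hx)
  · exact ContinuousOn.intervalIntegrable (by rwa [uIcc_of_le (by linarith)])

lemma aux_string {a r β : ℝ} (hr : 0 < r) {g w w' : ℝ → (Fin 2 → ℂ)}
    (hg : ContinuousOn g (Icc a (a + 1)))
    (hw : ∀ x ∈ Icc a (a + 1), HasDerivWithinAt w (w' x) (Icc a (a + 1)) x)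
    (heq : ∀ x ∈ Icc a (a + 1), (Complex.I * β) • w x -
            (!![0, 1; (r : ℂ), 0] : Matrix (Fin 2) (Fin 2) ℂ).mulVec (w' x) = g x) :
    (((w a 0).re * (w a 1).re + (w a 0).im * (w a 1).im) -
      ((w (a+1) 0).re * (w (a+1) 1).re + (w (a+1) 0).im * (w (a+1) 1).im) ≤
      (1 + 1 / r) * ∫ x in a..(a + 1), (‖w x 0‖ + ‖w x 1‖) * (‖g x 0‖ + ‖g x 1‖)) ∧
    ∀ y ∈ Icc a (a + 1), ‖w y 0‖ ^ 2 + ‖w y 1‖ ^ 2 ≤ (r + 2) * (1 + 1 / r) *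
      ((‖w a 0‖ ^ 2 + ‖w a 1‖ ^ 2) +
        ∫ x in a..(a + 1), (‖w x 0‖ + ‖w x 1‖) * (‖g x 0‖ + ‖g x 1‖)) := by
  have hwc : ContinuousOn w (Icc a (a + 1)) := fun x hx => (hw x hx).continuousWithinAt
  have hw0 := continuousOn_pi.1 hwc 0
  have hw1 := continuousOn_pi.1 hwc 1
  have hg0 := continuousOn_pi.1 hg 0
  have hg1 := continuousOn_pi.1 hg 1
  have hp : ContinuousOn (fun x => (‖w x 0‖ + ‖w x 1‖) * (‖g x 0‖ + ‖g x 1‖))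
      (Icc a (a + 1)) := (hw0.norm.add hw1.norm).mul (hg0.norm.add hg1.norm)
  have hre : ∀ i, ∀ x ∈ Icc a (a + 1), HasDerivWithinAt (fun x => (w x i).re) ((w' x i).re)
      (Icc a (a + 1)) x := fun i x hx =>
    Complex.reCLM.hasFDerivAt.comp_hasDerivWithinAt x ((hasDerivWithinAt_pi.1 (hw x hx)) i)
  have him : ∀ i, ∀ x ∈ Icc a (a + 1), HasDerivWithinAt (fun x => (w x i).im) ((w' x i).im)
      (Icc a (a + 1)) x := fun i x hx =>
    Complex.imCLM.hasFDerivAt.comp_hasDerivWithinAt x ((hasDerivWithinAt_pi.1 (hw x hx)) i)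
  have he : ∀ x ∈ Icc a (a + 1),
      (w' x 1).re = - β * (w x 0).im - (g x 0).re ∧ (w' x 1).im = β * (w x 0).re - (g x 0).im ∧
      (w' x 0).re = (- β * (w x 1).im - (g x 1).re) / r ∧
      (w' x 0).im = (β * (w x 1).re - (g x 1).im) / r := by
    intro x hx
    have h0 := congrFun (heq x hx) 0
    have h1 := congrFun (heq x hx) 1
    simp [Matrix.mulVec, dotProduct, Fin.sum_univ_two] at h0 h1
    have a1 := congrArg Complex.re h0
    have a2 := congrArg Complex.im h0
    have a3 := congrArg Complex.re h1
    have a4 := congrArg Complex.im h1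
    simp at a1 a2 a3 a4
    refine ⟨by linarith, by linarith, ?_, ?_⟩
    · rw [eq_div_iff hr.ne']; linarith
    · rw [eq_div_iff hr.ne']; linarith
  have hP0 : ∀ x, 0 ≤ (‖w x 0‖ + ‖w x 1‖) * (‖g x 0‖ + ‖g x 1‖) := fun x => by positivity
  have hri : 0 < 1 / r := by positivity
  constructor
  · have key := aux_mono (a := a)
      (f := fun x => -((w x 0).re * (w x 1).re + (w x 0).im * (w x 1).im))
      (q := fun x => (1 + 1 / r) * ((‖w x 0‖ + ‖w x 1‖) * (‖g x 0‖ + ‖g x 1‖)))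
      (fun x hx => ((((hre 0 x hx).mul (hre 1 x hx)).add ((him 0 x hx).mul (him 1 x hx))).neg))
      (hp.const_smul (1 + 1 / r)) (fun x _ => mul_nonneg (by positivity) (hP0 x)) ?_ (a + 1) (by simp)
    · rw [intervalIntegral.integral_const_mul] at key
      linarith
    · intro x hx
      obtain ⟨e1, e2, e3, e4⟩ := he x hx
      have b1 := (abs_le.1 (aux_re_s6 (w x 0) (g x 0))).2
      have b2 := (abs_le.1 (aux_re_s6 (w x 1) (g x 1))).2
      have b3 := mul_le_mul_of_nonneg_left b2 hri.le
      simp only [e1, e2, e3, e4]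
      have n1 : 0 ≤ ‖w x 0‖ * ‖g x 1‖ := by positivity
      have n2 : 0 ≤ ‖w x 1‖ * ‖g x 0‖ := by positivity
      have n3 : 0 ≤ ‖w x 1‖ * ‖g x 1‖ := by positivity
      have n4 : 0 ≤ (1 / r) * (‖w x 0‖ * ‖g x 0‖ + ‖w x 0‖ * ‖g x 1‖ + ‖w x 1‖ * ‖g x 0‖) := by
        positivity
      calc _ = ((w x 0).re * (g x 0).re + (w x 0).im * (g x 0).im)
            + 1 / r * ((w x 1).re * (g x 1).re + (w x 1).im * (g x 1).im) := by ring
        _ ≤ _ := by nlinarith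
  · intro y hy
    have key := aux_mono (a := a)
      (f := fun x => r * ((w x 0).re * (w x 0).re + (w x 0).im * (w x 0).im) +
        ((w x 1).re * (w x 1).re + (w x 1).im * (w x 1).im))
      (q := fun x => 2 * ((‖w x 0‖ + ‖w x 1‖) * (‖g x 0‖ + ‖g x 1‖)))
      (fun x hx => ((((hre 0 x hx).mul (hre 0 x hx)).add ((him 0 x hx).mul (him 0 x hx))).const_mul r).add
        (((hre 1 x hx).mul (hre 1 x hx)).add ((him 1 x hx).mul (him 1 x hx))))
      (hp.const_smul (2 : ℝ)) (fun x _ => mul_nonneg (by positivity) (hP0 x)) ?_ y hy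
    · rw [intervalIntegral.integral_const_mul] at key
      have hP : 0 ≤ ∫ x in a..(a + 1), (‖w x 0‖ + ‖w x 1‖) * (‖g x 0‖ + ‖g x 1‖) :=
        intervalIntegral.integral_nonneg (by linarith) (fun x _ => hP0 x)
      generalize (∫ x in a..(a + 1), (‖w x 0‖ + ‖w x 1‖) * (‖g x 0‖ + ‖g x 1‖)) = P at *
      simp only [← Complex.normSq_apply, Complex.normSq_eq_norm_sq] at key
      have m1 : 0 ≤ ‖w y 0‖ ^ 2 := by positivity
      have m2 : 0 ≤ ‖w y 1‖ ^ 2 := by positivity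
      have m3 : 0 ≤ ‖w a 0‖ ^ 2 := by positivity
      have m4 : 0 ≤ ‖w a 1‖ ^ 2 := by positivity
      generalize ‖w y 0‖ ^ 2 = A at *
      generalize ‖w y 1‖ ^ 2 = B at *
      generalize ‖w a 0‖ ^ 2 = A' at *
      generalize ‖w a 1‖ ^ 2 = B' at *
      have k1 : A + B ≤ (1 + 1 / r) * (r * A + B) := by
        have : (1 + 1 / r) * (r * A + B) = A + B + (r * A + 1 / r * B) := by
          field_simp; ring
        rw [this]
        have : 0 ≤ r * A + 1 / r * B := by positivity
        linarith
      have k2 : r * A + B ≤ (r + 2) * ((A' + B') + P) := by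
        nlinarith [mul_nonneg hr.le m4, mul_nonneg hr.le hP]
      calc A + B ≤ (1 + 1 / r) * (r * A + B) := k1
        _ ≤ (1 + 1 / r) * ((r + 2) * ((A' + B') + P)) :=
          mul_le_mul_of_nonneg_left k2 (by positivity)
        _ = _ := by ring
    · intro x hx
      obtain ⟨e1, e2, e3, e4⟩ := he x hx
      have b1 := (abs_le.1 (aux_re_s6 (w x 0) (g x 1))).1
      have b2 := (abs_le.1 (aux_re_s6 (w x 1) (g x 0))).1
      simp only [e1, e2, e3, e4]
      have n1 : 0 ≤ ‖w x 0‖ * ‖g x 0‖ := by positivity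
      have n2 : 0 ≤ ‖w x 1‖ * ‖g x 1‖ := by positivity
      calc _ = -2 * ((w x 0).re * (g x 1).re + (w x 0).im * (g x 1).im)
            - 2 * ((w x 1).re * (g x 0).re + (w x 1).im * (g x 0).im) := by
              field_simp; ring
        _ ≤ _ := by nlinarith

/-- constants of the propagation estimate -/
def auxc (D : ℝ) : ℕ → ℝ
  | 0 => 2 * D
  | n + 1 => D * (auxc D n + 1)

lemma auxc_pos {D : ℝ} (hD : 0 < D) (n : ℕ) : 0 < auxc D n := by
  induction n with
  | zero => simp [auxc, hD]
  | succ k ih => simp only [auxc]; positivity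

/-- uniform resolvent estimate on the imaginary axis for the first-order system
`iβ W_j − B(ρ_j) W_j' = G_j` on `[j, j+1]` (with `B(ρ) = !![0, 1; ρ, 0]`), transmission
conditions `W_{j−1}(j) = W_j(j)`, boundary conditions `(W₀(0))₁ = (W₀(0))₂` and
`(W_{N−1}(N))₁ = 0`: there is `C > 0` independent of `β` such that
`Σ_j ∫_j^{j+1} ‖W_j‖² ≤ C Σ_j ∫_j^{j+1} ‖G_j‖²` (Euclidean norms on ℂ², written
componentwise). -/
theorem stmt6 (N : ℕ) (hN : 1 ≤ N) (ρ : ℕ → ℝ) (hρ : ∀ j < N, 0 < ρ j) :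
    ∃ C : ℝ, 0 < C ∧
      ∀ (β : ℝ) (G W W' : ℕ → ℝ → (Fin 2 → ℂ)),
        (∀ j < N, ContinuousOn (G j) (Icc (j : ℝ) (j + 1))) →
        (∀ j < N, ∀ x ∈ Icc (j : ℝ) (j + 1),
          HasDerivWithinAt (W j) (W' j x) (Icc (j : ℝ) (j + 1)) x) →
        (∀ j < N, ContinuousOn (W' j) (Icc (j : ℝ) (j + 1))) →
        (∀ j < N, ∀ x ∈ Icc (j : ℝ) (j + 1),
          (Complex.I * β) • W j x -
            (!![0, 1; (ρ j : ℂ), 0] : Matrix (Fin 2) (Fin 2) ℂ).mulVec (W' j x) = G j x) →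
        (∀ j, 1 ≤ j → j ≤ N - 1 → W (j - 1) j = W j j) →
        (W 0 0 0 = W 0 0 1) →
        (W (N - 1) N 0 = 0) →
        ∑ j ∈ Finset.range N, ∫ x in (j : ℝ)..(j + 1), (‖W j x 0‖ ^ 2 + ‖W j x 1‖ ^ 2) ≤
          C * ∑ j ∈ Finset.range N, ∫ x in (j : ℝ)..(j + 1), (‖G j x 0‖ ^ 2 + ‖G j x 1‖ ^ 2) := by
  set D : ℝ := 1 + ∑ j ∈ Finset.range N, (ρ j + 2) * (1 + 1 / ρ j) with hDdef
  have hLpos : ∀ j ∈ Finset.range N, 0 ≤ (ρ j + 2) * (1 + 1 / ρ j) := by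
    intro j hj
    have := hρ j (Finset.mem_range.1 hj)
    positivity
  have hD : 0 < D := by
    have := Finset.sum_nonneg hLpos
    linarith
  have hL : ∀ j < N, (ρ j + 2) * (1 + 1 / ρ j) ≤ D := by
    intro j hj
    have := Finset.single_le_sum hLpos (Finset.mem_range.2 hj)
    linarith
  have hM : ∀ j < N, 1 + 1 / ρ j ≤ D := by
    intro j hj
    have h0 := hρ j hj
    have h1 : 0 < 1 / ρ j := by positivity
    nlinarith [hL j hj]
  set K : ℝ := ∑ j ∈ Finset.range N, auxc D (j + 1) with hKdef
  have hK : 0 < K := Finset.sum_pos (fun j _ => auxc_pos hD _) ⟨0, Finset.mem_range.2 hN⟩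
  refine ⟨4 * K ^ 2, by positivity, ?_⟩
  intro β G W W' hG hW _ heq htr hb0 hbN
  set p : ℕ → ℝ := fun j => ∫ x in (j : ℝ)..(j + 1),
    (‖W j x 0‖ + ‖W j x 1‖) * (‖G j x 0‖ + ‖G j x 1‖) with hpdef
  have hp0 : ∀ j, 0 ≤ p j := fun j =>
    intervalIntegral.integral_nonneg (by linarith) (fun x _ => by positivity)
  set P : ℝ := ∑ j ∈ Finset.range N, p j with hPdef
  have hP0 : 0 ≤ P := Finset.sum_nonneg (fun j _ => hp0 j)
  have hpP : ∀ j < N, p j ≤ P := fun j hj =>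
    Finset.single_le_sum (fun j _ => hp0 j) (Finset.mem_range.2 hj)
  have hs := fun j (hj : j < N) => aux_string (hρ j hj) (hG j hj) (hW j hj) (heq j hj)
  have htr' : ∀ j, j + 1 < N → W (j + 1) ((j : ℝ) + 1) = W j ((j : ℝ) + 1) := by
    intro j hj
    have := htr (j + 1) (by omega) (by omega)
    simpa using this.symm
  -- flux
  let F : ℕ → ℝ → ℝ := fun j x => (W j x 0).re * (W j x 1).re + (W j x 0).im * (W j x 1).im
  have hF : ∀ j < N, F j j - F j (j + 1) ≤ D * p j := fun j hj =>
    (hs j hj).1.trans (mul_le_mul_of_nonneg_right (hM j hj) (hp0 j))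
  have hFs : ∀ n, n < N → F 0 0 - F n (n + 1) ≤ D * ∑ j ∈ Finset.range (n + 1), p j := by
    intro n
    induction n with
    | zero => intro h; simpa using hF 0 h
    | succ k ih =>
      intro h
      have h1 := ih (by omega)
      have h2 := hF (k + 1) h
      have h3 : F (k + 1) ((k : ℝ) + 1) = F k ((k : ℝ) + 1) := by
        simp only [F]; rw [htr' k h]
      rw [Finset.sum_range_succ]
      push_cast at h2 ⊢
      linarith
  have hFN : F 0 0 ≤ D * P := by
    have h1 := hFs (N - 1) (by omega)
    have h2 : ((N - 1 : ℕ) : ℝ) + 1 = N := by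
      have : N - 1 + 1 = N := by omega
      exact_mod_cast this
    have h3 : N - 1 + 1 = N := by omega
    rw [h2, h3] at h1
    have h4 : F (N - 1) N = 0 := by simp [F, hbN]
    linarith
  let n : ℕ → ℝ → ℝ := fun j x => ‖W j x 0‖ ^ 2 + ‖W j x 1‖ ^ 2
  have hstep : ∀ j < N, n j j ≤ auxc D j * P → ∀ y ∈ Icc (j : ℝ) (j + 1),
      n j y ≤ auxc D (j + 1) * P := by
    intro j hj h y hy
    have h1 := (hs j hj).2 y hy
    have h2 : 0 ≤ n j j + p j := add_nonneg (by positivity) (hp0 j)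
    calc n j y ≤ (ρ j + 2) * (1 + 1 / ρ j) * (n j j + p j) := h1
      _ ≤ D * (n j j + p j) := mul_le_mul_of_nonneg_right (hL j hj) h2
      _ ≤ D * (auxc D j * P + P) := mul_le_mul_of_nonneg_left (add_le_add h (hpP j hj)) hD.le
      _ = _ := by simp only [auxc]; ring
  have hn : ∀ j < N, n j j ≤ auxc D j * P := by
    intro j
    induction j with
    | zero =>
      intro _
      have : n 0 0 = 2 * F 0 0 := by
        simp only [n, F, hb0, ← Complex.normSq_eq_norm_sq, Complex.normSq_apply]; ring
      simp only [auxc, Nat.cast_zero]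
      linarith
    | succ k ih =>
      intro h
      have h1 := hstep k (by omega) (ih (by omega)) (k + 1) (by simp)
      have h3 : n (k + 1) ((k : ℝ) + 1) = n k ((k : ℝ) + 1) := by
        simp only [n]; rw [htr' k h]
      push_cast
      linarith
  have hWc : ∀ j < N, ∀ i, ContinuousOn (fun x => W j x i) (uIcc (j : ℝ) (j + 1)) := by
    intro j hj i
    rw [uIcc_of_le (by linarith)]
    exact continuousOn_pi.1 (fun x hx => (hW j hj x hx).continuousWithinAt) i
  have hGc : ∀ j < N, ∀ i, ContinuousOn (fun x => G j x i) (uIcc (j : ℝ) (j + 1)) := by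
    intro j hj i
    rw [uIcc_of_le (by linarith)]
    exact continuousOn_pi.1 (hG j hj) i
  have hnI : ∀ j < N, IntervalIntegrable (fun x => ‖W j x 0‖ ^ 2 + ‖W j x 1‖ ^ 2)
      MeasureTheory.volume (j : ℝ) (j + 1) := fun j hj =>
    (((hWc j hj 0).norm.pow 2).add ((hWc j hj 1).norm.pow 2)).intervalIntegrable
  have hgI : ∀ j < N, IntervalIntegrable (fun x => ‖G j x 0‖ ^ 2 + ‖G j x 1‖ ^ 2)
      MeasureTheory.volume (j : ℝ) (j + 1) := fun j hj =>
    (((hGc j hj 0).norm.pow 2).add ((hGc j hj 1).norm.pow 2)).intervalIntegrable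
  have hpI : ∀ j < N, IntervalIntegrable
      (fun x => (‖W j x 0‖ + ‖W j x 1‖) * (‖G j x 0‖ + ‖G j x 1‖))
      MeasureTheory.volume (j : ℝ) (j + 1) := fun j hj =>
    (((hWc j hj 0).norm.add (hWc j hj 1).norm).mul
      ((hGc j hj 0).norm.add (hGc j hj 1).norm)).intervalIntegrable
  set S : ℝ := ∑ j ∈ Finset.range N, ∫ x in (j : ℝ)..(j + 1), (‖W j x 0‖ ^ 2 + ‖W j x 1‖ ^ 2)
    with hS
  set Γ : ℝ := ∑ j ∈ Finset.range N, ∫ x in (j : ℝ)..(j + 1), (‖G j x 0‖ ^ 2 + ‖G j x 1‖ ^ 2)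
    with hΓ
  have hSK : S ≤ K * P := by
    rw [hS, hKdef, Finset.sum_mul]
    refine Finset.sum_le_sum (fun j hj => ?_)
    have hj := Finset.mem_range.1 hj
    calc _ ≤ ∫ x in (j : ℝ)..(j + 1), auxc D (j + 1) * P :=
          intervalIntegral.integral_mono_on (by linarith) (hnI j hj)
            intervalIntegrable_const (fun x hx => hstep j hj (hn j hj) x hx)
      _ = _ := by simp
  have hPK : K * P ≤ 1 / 2 * S + 2 * K ^ 2 * Γ := by
    rw [hS, hΓ, hPdef, Finset.mul_sum, Finset.mul_sum, Finset.mul_sum, ← Finset.sum_add_distrib]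
    refine Finset.sum_le_sum (fun j hj => ?_)
    have hj := Finset.mem_range.1 hj
    simp only [hpdef]
    rw [← intervalIntegral.integral_const_mul, ← intervalIntegral.integral_const_mul,
      ← intervalIntegral.integral_const_mul, ← intervalIntegral.integral_add
        ((hnI j hj).const_mul _) ((hgI j hj).const_mul _)]
    refine intervalIntegral.integral_mono_on (by linarith) ((hpI j hj).const_mul _)
      (((hnI j hj).const_mul _).add ((hgI j hj).const_mul _)) (fun x _ => ?_)
    generalize ‖W j x 0‖ = a
    generalize ‖W j x 1‖ = b
    generalize ‖G j x 0‖ = c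
    generalize ‖G j x 1‖ = d
    nlinarith [sq_nonneg (a - 2 * K * c), sq_nonneg (a - 2 * K * d), sq_nonneg (b - 2 * K * c),
      sq_nonneg (b - 2 * K * d)]
  linarith
end

section
/- Let N ≥ 1 and ρ₀, …, ρ_{N−1} > 0. Suppose u₀, …, u_{N−1} with u_j : [j, j+1] → ℂ twice continuously differentiable and v₀, …, v_{N−1} with v_j : [j, j+1] → ℂ continuously differentiable satisfy: ρ₀·u₀'(0) = v₀(0); the flux conditions ρ_{j−1}·u_{j−1}'(j) = ρ_j·u_j'(j) for j = 1, …, N−1; the continuity conditions v_{j−1}(j) = v_j(j) for j = 1, …, N−1; and v_{N−1}(N) = 0. Then Re( Σ_{j=0}^{N−1} ∫_j^{j+1} ( ρ_j·u_j''(x)·conj(v_j(x)) + ρ_j·v_j'(x)·conj(u_j'(x)) ) dx ) = −|v₀(0)|². -/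
open Complex Set

theorem piece_aux (r a b : ℝ) (hab : a ≤ b) (p p' v v' : ℝ → ℂ)
    (hp : ∀ x ∈ Icc a b, HasDerivWithinAt p (p' x) (Icc a b) x)
    (hpc : ContinuousOn p' (Icc a b))
    (hv : ∀ x ∈ Icc a b, HasDerivWithinAt v (v' x) (Icc a b) x)
    (hvc : ContinuousOn v' (Icc a b)) :
    (∫ x in a..b, ((r : ℂ) * p' x * (starRingEnd ℂ) (v x) +
          (r : ℂ) * v' x * (starRingEnd ℂ) (p x))).re =
      ((r : ℂ) * p b * (starRingEnd ℂ) (v b)).re -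
        ((r : ℂ) * p a * (starRingEnd ℂ) (v a)).re := by
  have cp : ContinuousOn p (Icc a b) := fun x hx => (hp x hx).continuousWithinAt
  have cv : ContinuousOn v (Icc a b) := fun x hx => (hv x hx).continuousWithinAt
  have cc : Continuous (starRingEnd ℂ) := Complex.continuous_conj
  have c1 : ContinuousOn (fun x => (r : ℂ) * p' x * (starRingEnd ℂ) (v x) +
          (r : ℂ) * v' x * (starRingEnd ℂ) (p x)) (Icc a b) :=
    ((continuousOn_const.mul hpc).mul (cc.comp_continuousOn cv)).add
      ((continuousOn_const.mul hvc).mul (cc.comp_continuousOn cp))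
  have i1 := c1.intervalIntegrable_of_Icc (μ := MeasureTheory.volume) hab
  have h1 := Complex.reCLM.intervalIntegral_comp_comm i1
  simp only [Complex.reCLM_apply] at h1
  rw [← h1]
  refine intervalIntegral.integral_eq_sub_of_hasDerivAt_of_le
    (f := fun x => ((r : ℂ) * p x * (starRingEnd ℂ) (v x)).re) hab ?_ ?_ ?_
  · exact Complex.continuous_re.comp_continuousOn
      ((continuousOn_const.mul cp).mul (cc.comp_continuousOn cv))
  · intro x hx
    have hn : Icc a b ∈ nhds x := Icc_mem_nhds hx.1 hx.2
    have d1 := (hp x (Ioo_subset_Icc_self hx)).hasDerivAt hn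
    have d2 := (hv x (Ioo_subset_Icc_self hx)).hasDerivAt hn
    have d3 := Complex.conjCLE.toContinuousLinearMap.hasFDerivAt.comp_hasDerivAt x d2
    have d4 := Complex.reCLM.hasFDerivAt.comp_hasDerivAt x ((d1.const_mul (r : ℂ)).mul d3)
    refine HasDerivAt.congr_deriv d4 ?_
    simp
    ring
  · exact (Complex.continuous_re.comp_continuousOn c1).intervalIntegrable_of_Icc hab

/-- dissipativity identity
`Re Σ_j ∫_j^{j+1} (ρ_j u_j'' conj v_j + ρ_j v_j' conj u_j') = −|v₀(0)|²`
under the conditions `ρ₀ u₀'(0) = v₀(0)`, the flux conditions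
`ρ_{j−1} u_{j−1}'(j) = ρ_j u_j'(j)`, the continuity conditions `v_{j−1}(j) = v_j(j)`,
and `v_{N−1}(N) = 0`.  (`u' j`, `u'' j` are the first and second derivatives of `u j` and
`v' j` is the derivative of `v j` on `[j, j+1]`.) -/
theorem stmt7 (N : ℕ) (hN : 1 ≤ N) (ρ : ℕ → ℝ) (hρ : ∀ j < N, 0 < ρ j)
    (u u' u'' v v' : ℕ → ℝ → ℂ)
    (hu1 : ∀ j < N, ∀ x ∈ Icc (j : ℝ) (j + 1),
      HasDerivWithinAt (u j) (u' j x) (Icc (j : ℝ) (j + 1)) x)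
    (hu2 : ∀ j < N, ∀ x ∈ Icc (j : ℝ) (j + 1),
      HasDerivWithinAt (u' j) (u'' j x) (Icc (j : ℝ) (j + 1)) x)
    (hu2c : ∀ j < N, ContinuousOn (u'' j) (Icc (j : ℝ) (j + 1)))
    (hv1 : ∀ j < N, ∀ x ∈ Icc (j : ℝ) (j + 1),
      HasDerivWithinAt (v j) (v' j x) (Icc (j : ℝ) (j + 1)) x)
    (hv1c : ∀ j < N, ContinuousOn (v' j) (Icc (j : ℝ) (j + 1)))
    (hbc0 : (ρ 0 : ℂ) * u' 0 0 = v 0 0)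
    (hflux : ∀ j, 1 ≤ j → j ≤ N - 1 → (ρ (j - 1) : ℂ) * u' (j - 1) j = (ρ j : ℂ) * u' j j)
    (hcont_node : ∀ j, 1 ≤ j → j ≤ N - 1 → v (j - 1) j = v j j)
    (hbcN : v (N - 1) N = 0) :
    (∑ j ∈ Finset.range N, ∫ x in (j : ℝ)..(j + 1),
        ((ρ j : ℂ) * u'' j x * (starRingEnd ℂ) (v j x) +
          (ρ j : ℂ) * v' j x * (starRingEnd ℂ) (u' j x))).re = -‖v 0 0‖ ^ 2 := by
  have key : ∀ n < N, (∑ j ∈ Finset.range (n + 1), ∫ x in (j : ℝ)..(j + 1),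
        ((ρ j : ℂ) * u'' j x * (starRingEnd ℂ) (v j x) +
          (ρ j : ℂ) * v' j x * (starRingEnd ℂ) (u' j x))).re =
      ((ρ n : ℂ) * u' n ((n + 1 : ℕ) : ℝ) * (starRingEnd ℂ) (v n ((n + 1 : ℕ) : ℝ))).re
        - ‖v 0 0‖ ^ 2 := by
    intro n
    induction n with
    | zero =>
      intro h
      have := piece_aux (ρ 0) ((0 : ℕ) : ℝ) ((0 : ℕ) + 1) (by simp) (u' 0) (u'' 0) (v 0) (v' 0)
        (hu2 0 h) (hu2c 0 h) (hv1 0 h) (hv1c 0 h)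
      rw [Finset.sum_range_one, this, Nat.cast_add, Nat.cast_one, Nat.cast_zero, hbc0,
        Complex.mul_conj, Complex.ofReal_re, Complex.normSq_eq_norm_sq]
    | succ n ih =>
      intro h
      have := piece_aux (ρ (n + 1)) ((n + 1 : ℕ) : ℝ) ((n + 1 : ℕ) + 1) (by simp)
        (u' (n + 1)) (u'' (n + 1)) (v (n + 1)) (v' (n + 1))
        (hu2 _ h) (hu2c _ h) (hv1 _ h) (hv1c _ h)
      have f1 := hflux (n + 1) (by omega) (by omega)
      have f2 := hcont_node (n + 1) (by omega) (by omega)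
      rw [Nat.add_sub_cancel] at f1 f2
      rw [Finset.sum_range_succ, Complex.add_re, this, ih (by omega), f1, f2,
        Nat.cast_add (n + 1) 1, Nat.cast_one]
      ring
  have h := key (N - 1) (by omega)
  rw [Nat.sub_add_cancel hN, hbcN] at h
  rw [h]
  simp
end

section
/- Let a, b ∈ ℂ, c > 0 and λ ∈ ℂ with Re λ = γ. Set D' = cosh(λ/c)·a + (1/c)·sinh(λ/c)·b and D̃' = c·sinh(λ/c)·a + cosh(λ/c)·b. Then Re(D' · conj(D̃')) = (1/2)·sinh(2γ/c)·( c·|a|² + |b|²/c ) + cosh(2γ/c)·Re(a · conj(b)). -/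
open Complex

/-- for `a b : ℂ`, `c > 0` and `λ ∈ ℂ` with `Re λ = γ`, setting
`D' = cosh(λ/c)·a + (1/c)·sinh(λ/c)·b` and `D̃' = c·sinh(λ/c)·a + cosh(λ/c)·b`, one has
`Re (D'·conj D̃') = (1/2)·sinh(2γ/c)·(c·|a|² + |b|²/c) + cosh(2γ/c)·Re (a·conj b)`. -/
theorem stmt10 (a b : ℂ) (c : ℝ) (hc : 0 < c) (γ : ℝ) (lam : ℂ) (hlam : lam.re = γ)
    (D' : ℂ) (hD' : D' = Complex.cosh (lam / c) * a + (1 / (c : ℂ)) * Complex.sinh (lam / c) * b)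
    (Dt' : ℂ) (hDt' : Dt' = (c : ℂ) * Complex.sinh (lam / c) * a + Complex.cosh (lam / c) * b) :
    (D' * (starRingEnd ℂ) Dt').re =
      (1 / 2) * Real.sinh (2 * γ / c) * (c * ‖a‖ ^ 2 + ‖b‖ ^ 2 / c) +
        Real.cosh (2 * γ / c) * (a * (starRingEnd ℂ) b).re := by
  have hc0 : c ≠ 0 := hc.ne'
  have hz : lam / (c : ℂ) = ((γ / c : ℝ) : ℂ) + ((lam.im / c : ℝ) : ℂ) * I := by
    apply Complex.ext
    · rw [Complex.div_ofReal_re]; simp [hlam, -Complex.ofReal_div]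
    · rw [Complex.div_ofReal_im]; simp [-Complex.ofReal_div]
  have h2 : 2 * γ / c = 2 * (γ / c) := by ring
  rw [h2, Real.sinh_two_mul, Real.cosh_two_mul, hD', hDt', hz]
  generalize γ / c = x
  generalize lam.im / c = y
  rw [Complex.cosh_add, Complex.sinh_add, Complex.cosh_mul_I, Complex.sinh_mul_I,
    ← Complex.ofReal_cosh, ← Complex.ofReal_sinh, ← Complex.ofReal_cos, ← Complex.ofReal_sin]
  have ht := Real.sin_sq_add_cos_sq y
  generalize Real.sin y = s at *
  generalize Real.cos y = k at *
  generalize Real.sinh x = S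
  generalize Real.cosh x = C
  have hi : (1 / (c : ℂ)) = ((c⁻¹ : ℝ) : ℂ) := by push_cast; ring
  rw [hi, Complex.sq_norm, Complex.sq_norm, Complex.normSq_apply, Complex.normSq_apply, div_eq_mul_inv _ c]
  have hcd : c * c⁻¹ = 1 := mul_inv_cancel₀ hc0
  generalize c⁻¹ = d at *
  simp only [Complex.mul_re, Complex.mul_im, Complex.add_re, Complex.add_im, Complex.conj_re,
    Complex.conj_im, Complex.ofReal_re, Complex.ofReal_im, Complex.I_re, Complex.I_im]
  linear_combination (S * C * (c * (a.re * a.re + a.im * a.im) + (b.re * b.re + b.im * b.im) * d)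
    + (C ^ 2 + S ^ 2) * (a.re * b.re + a.im * b.im)) * ht
    + ((S*k)^2 + (C*s)^2) * (a.re * b.re + a.im * b.im) * hcd
end

section
/- Let N ≥ 1, ρ₀, …, ρ_{N−1} > 0, and set c_j = √ρ_j for each j. Define, for λ ∈ ℂ, D₀(λ) = −cosh(λ/c₀) and D̃₀(λ) = −sinh(λ/c₀), and recursively for 1 ≤ n ≤ N−1: D_n(λ) = cosh(λ/c_n)·D_{n−1}(λ) + (1/c_n)·sinh(λ/c_n)·D̃_{n−1}(λ) and D̃_n(λ) = c_n·sinh(λ/c_n)·D_{n−1}(λ) + cosh(λ/c_n)·D̃_{n−1}(λ). Then for every γ > 0 there exist constants k > 0 and k' > 0 (depending only on γ, N and ρ₀, …, ρ_{N−1}) such that for every λ ∈ ℂ with Re λ = γ one has Re(D_{N−1}(λ) · conj(D̃_{N−1}(λ))) ≥ k and |D_{N−1}(λ)| ≥ k'. -/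
open Complex

lemma aux_cs (z : ℂ) : (cosh z).re * (sinh z).re + (cosh z).im * (sinh z).im
      = Real.sinh (2 * z.re) / 2 ∧
    (cosh z).re ^ 2 + (cosh z).im ^ 2 + (sinh z).re ^ 2 + (sinh z).im ^ 2
      = Real.cosh (2 * z.re) := by
  have hp : (exp z).re ^ 2 + (exp z).im ^ 2 = Real.exp (2 * z.re) := by
    rw [exp_re, exp_im, two_mul, Real.exp_add]
    linear_combination (Real.exp z.re) ^ 2 * Real.sin_sq_add_cos_sq z.im
  have hq : (exp (-z)).re ^ 2 + (exp (-z)).im ^ 2 = Real.exp (-(2 * z.re)) := by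
    rw [exp_re, exp_im, two_mul, neg_add, Real.exp_add, neg_re]
    linear_combination (Real.exp (-z.re)) ^ 2 * Real.sin_sq_add_cos_sq ((-z).im)
  have e1 : cosh z = ((1 / 2 : ℝ) : ℂ) * (exp z + exp (-z)) := by
    rw [Complex.cosh]; push_cast; ring
  have e2 : sinh z = ((1 / 2 : ℝ) : ℂ) * (exp z - exp (-z)) := by
    rw [Complex.sinh]; push_cast; ring
  rw [e1, e2, Real.sinh_eq, Real.cosh_eq, ← hp, ← hq]
  simp only [re_ofReal_mul, im_ofReal_mul, add_re, add_im, sub_re, sub_im]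
  constructor <;> ring

lemma aux_bd_s11 (z : ℂ) : ‖cosh z‖ ^ 2 ≤ Real.cosh (2 * z.re) ∧
    ‖sinh z‖ ^ 2 ≤ Real.cosh (2 * z.re) := by
  have h := (aux_cs z).2
  rw [← normSq_eq_norm_sq, ← normSq_eq_norm_sq, normSq_apply, normSq_apply]
  constructor <;> nlinarith [sq_nonneg (cosh z).re, sq_nonneg (cosh z).im,
    sq_nonneg (sinh z).re, sq_nonneg (sinh z).im]

lemma aux_bd' (z : ℂ) : ‖cosh z‖ ≤ Real.cosh (2 * z.re) ∧
    ‖sinh z‖ ≤ Real.cosh (2 * z.re) := by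
  have h := aux_bd_s11 z
  have h1 := Real.one_le_cosh (2 * z.re)
  constructor <;> nlinarith [norm_nonneg (cosh z), norm_nonneg (sinh z)]

lemma aux_step (z a b : ℂ) (c : ℝ) (hc : 0 < c) (hz : 0 < z.re)
    (hab : 0 ≤ (a * (starRingEnd ℂ) b).re) :
    (a * (starRingEnd ℂ) b).re ≤ ((cosh z * a + (1 / (c : ℂ)) * sinh z * b) *
      (starRingEnd ℂ) ((c : ℂ) * sinh z * a + cosh z * b)).re := by
  obtain ⟨h1, h2⟩ := aux_cs z
  have h3 : 0 < Real.sinh (2 * z.re) := Real.sinh_pos_iff.2 (by linarith)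
  have h4 := Real.one_le_cosh (2 * z.re)
  have key : ((cosh z * a + (1 / (c : ℂ)) * sinh z * b) *
      (starRingEnd ℂ) ((c : ℂ) * sinh z * a + cosh z * b)).re
      = (c * normSq a + c⁻¹ * normSq b) * (Real.sinh (2 * z.re) / 2)
        + Real.cosh (2 * z.re) * (a * (starRingEnd ℂ) b).re := by
    rw [← h1, ← h2]
    have e : (1 / (c : ℂ)) = ((c⁻¹ : ℝ) : ℂ) := by push_cast; ring
    have hcc : c * c⁻¹ = 1 := mul_inv_cancel₀ hc.ne'
    rw [e, mul_assoc, mul_assoc]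
    generalize c⁻¹ = d at *
    simp only [mul_re, mul_im, add_re, add_im, conj_re, conj_im, ofReal_re, ofReal_im,
      normSq_apply]
    linear_combination ((sinh z).re ^ 2 + (sinh z).im ^ 2) * (a.re * b.re + a.im * b.im) * hcc
  rw [key]
  have : 0 ≤ (c * normSq a + c⁻¹ * normSq b) * (Real.sinh (2 * z.re) / 2) := by
    have := normSq_nonneg a
    have := normSq_nonneg b
    positivity
  nlinarith

/-- with `c_j = √ρ_j`, `D₀(λ) = −cosh(λ/c₀)`, `D̃₀(λ) = −sinh(λ/c₀)` and the
recursion `D_n = cosh(λ/c_n)·D_{n−1} + (1/c_n)·sinh(λ/c_n)·D̃_{n−1}`,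
`D̃_n = c_n·sinh(λ/c_n)·D_{n−1} + cosh(λ/c_n)·D̃_{n−1}` for `1 ≤ n ≤ N−1`, for every `γ > 0`
there are `k, k' > 0` such that `Re (D_{N−1}(λ)·conj (D̃_{N−1}(λ))) ≥ k` and
`|D_{N−1}(λ)| ≥ k'` whenever `Re λ = γ`. -/
theorem stmt11 (N : ℕ) (hN : 1 ≤ N) (ρ : ℕ → ℝ) (hρ : ∀ j < N, 0 < ρ j)
    (c : ℕ → ℝ) (hcdef : ∀ j < N, c j = Real.sqrt (ρ j))
    (D Dt : ℕ → ℂ → ℂ)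
    (hD0 : ∀ lam : ℂ, D 0 lam = -Complex.cosh (lam / (c 0 : ℂ)))
    (hDt0 : ∀ lam : ℂ, Dt 0 lam = -Complex.sinh (lam / (c 0 : ℂ)))
    (hDrec : ∀ n, 1 ≤ n → n ≤ N - 1 → ∀ lam : ℂ,
      D n lam = Complex.cosh (lam / (c n : ℂ)) * D (n - 1) lam +
        (1 / (c n : ℂ)) * Complex.sinh (lam / (c n : ℂ)) * Dt (n - 1) lam)
    (hDtrec : ∀ n, 1 ≤ n → n ≤ N - 1 → ∀ lam : ℂ,
      Dt n lam = (c n : ℂ) * Complex.sinh (lam / (c n : ℂ)) * D (n - 1) lam +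
        Complex.cosh (lam / (c n : ℂ)) * Dt (n - 1) lam) :
    ∀ γ : ℝ, 0 < γ → ∃ k k' : ℝ, 0 < k ∧ 0 < k' ∧
      ∀ lam : ℂ, lam.re = γ →
        k ≤ (D (N - 1) lam * (starRingEnd ℂ) (Dt (N - 1) lam)).re ∧
          k' ≤ ‖D (N - 1) lam‖ := by
  intro γ hγ
  have hc : ∀ j < N, 0 < c j := fun j hj => by
    rw [hcdef j hj]; exact Real.sqrt_pos.2 (hρ j hj)
  have hre : ∀ (lam : ℂ) (j : ℕ), lam.re = γ → (lam / (c j : ℂ)).re = γ / c j := by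
    intro lam j h
    rw [div_ofReal_re, h]
  have main : ∀ n, n ≤ N - 1 → ∃ k M : ℝ, 0 < k ∧ 0 < M ∧ ∀ lam : ℂ, lam.re = γ →
      k ≤ (D n lam * (starRingEnd ℂ) (Dt n lam)).re ∧ ‖D n lam‖ ≤ M ∧ ‖Dt n lam‖ ≤ M := by
    intro n
    induction n with
    | zero =>
      intro _
      have h0 : 0 < γ / c 0 := div_pos hγ (hc 0 (by omega))
      refine ⟨Real.sinh (2 * (γ / c 0)) / 2, Real.cosh (2 * (γ / c 0)),
        half_pos (Real.sinh_pos_iff.2 (by linarith)), Real.cosh_pos _, ?_⟩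
      intro lam hl
      have h1 := (aux_cs (lam / (c 0 : ℂ))).1
      have h2 := aux_bd' (lam / (c 0 : ℂ))
      rw [hre lam 0 hl] at h1 h2
      rw [hD0, hDt0, norm_neg, norm_neg]
      refine ⟨?_, h2⟩
      rw [← h1]
      simp only [mul_re, conj_re, conj_im, neg_re, neg_im]
      apply le_of_eq
      ring
    | succ n ih =>
      intro hn
      obtain ⟨k, M, hk, hM, h⟩ := ih (by omega)
      have hcn := hc (n + 1) (by omega)
      have h0 : 0 < γ / c (n + 1) := div_pos hγ hcn
      set K := Real.cosh (2 * (γ / c (n + 1))) with hK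
      have hKp : 0 < K := Real.cosh_pos _
      set d := c (n + 1) with hd
      refine ⟨k, K * M + 1 / d * K * M + (d * K * M + K * M), hk, by positivity, ?_⟩
      intro lam hl
      obtain ⟨g1, g2, g3⟩ := h lam hl
      have h2 := aux_bd' (lam / (d : ℂ))
      have hr := hre lam (n + 1) hl
      rw [← hd] at hr
      rw [hr, ← hK] at h2
      have eD := hDrec (n + 1) (by omega) hn lam
      have eT := hDtrec (n + 1) (by omega) hn lam
      rw [Nat.add_sub_cancel, ← hd] at eD eT
      rw [eD, eT]
      have hdn : ‖(d : ℂ)‖ = d := by rw [norm_real, Real.norm_of_nonneg hcn.le]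
      refine ⟨g1.trans (aux_step _ _ _ d hcn (by rw [hr]; exact h0) (hk.le.trans g1)), ?_, ?_⟩
      · refine (norm_add_le _ _).trans ?_
        rw [norm_mul, norm_mul, norm_mul, norm_div, norm_one, hdn]
        have : 0 ≤ d * K * M + K * M := by positivity
        refine le_trans ?_ (le_add_of_nonneg_right this)
        gcongr
        exacts [h2.1, h2.2]
      · refine (norm_add_le _ _).trans ?_
        rw [norm_mul, norm_mul, norm_mul, hdn]
        have : 0 ≤ K * M + 1 / d * K * M := by positivity
        refine le_trans ?_ (le_add_of_nonneg_left this)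
        gcongr
        exacts [h2.2, h2.1]
  obtain ⟨k, M, hk, hM, h⟩ := main (N - 1) le_rfl
  refine ⟨k, k / M, hk, div_pos hk hM, fun lam hl => ?_⟩
  obtain ⟨g1, g2, g3⟩ := h lam hl
  refine ⟨g1, ?_⟩
  rw [div_le_iff₀ hM]
  refine g1.trans ((re_le_norm _).trans ?_)
  rw [norm_mul, norm_conj]
  gcongr
end

section
/- Let N ≥ 1, ρ₀, …, ρ_{N−1} > 0 and γ > 0. There exists a constant c_γ > 0, depending only on γ, N and ρ₀, …, ρ_{N−1}, with the following property: for every λ ∈ ℂ with Re λ = γ, every z ∈ ℂ, and every family W = (W₀, …, W_{N−1}) of continuously differentiable functions W_j : [j, j+1] → ℂ² satisfying λ·W_j(x) = B(ρ_j)·W_j'(x) on [j, j+1] for each j, the transmission conditions W_{j−1}(j) = W_j(j) for j = 1, …, N−1, the boundary condition that the second component of W₀(0) equals z, and the boundary condition that the first component of W_{N−1}(N) equals 0, one has |first component of W₀(0)| ≤ c_γ·|z|. -/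
open Complex Set Matrix

lemma exp_sol (f : ℝ → ℂ) (μ : ℂ) (a : ℝ)
    (hf : ∀ x ∈ Icc a (a + 1), HasDerivWithinAt f (μ * f x) (Icc a (a + 1)) x) :
    f (a + 1) = Complex.exp μ * f a := by
  have hg : ∀ x ∈ Icc a (a + 1), HasDerivWithinAt
      (fun y : ℝ => Complex.exp (-(μ * ((y : ℂ) - a))) * f y) 0 (Icc a (a + 1)) x := by
    intro x hx
    have h1 : HasDerivAt (fun y : ℝ => Complex.exp (-(μ * ((y : ℂ) - a))))
        (Complex.exp (-(μ * ((x : ℂ) - a))) * (-(μ * 1))) x :=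
      ((((Complex.ofRealCLM.hasDerivAt (x := x)).sub_const (a : ℂ)).const_mul μ).neg).cexp
    have h2 := h1.hasDerivWithinAt.mul (hf x hx)
    refine h2.congr_deriv ?_
    ring
  have hc := constant_of_has_deriv_right_zero
    (f := fun y : ℝ => Complex.exp (-(μ * ((y : ℂ) - a))) * f y) (a := a) (b := a + 1)
    (fun x hx => (hg x hx).continuousWithinAt)
    (fun x hx => ((hg x ⟨hx.1, hx.2.le⟩).mono_of_mem_nhdsWithin (Icc_mem_nhdsGE_of_mem hx)))
    (a + 1) ⟨by linarith, le_refl _⟩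
  simp at hc
  rw [← hc, ← mul_assoc, ← Complex.exp_add]
  simp

lemma sq_diff (u v : ℂ) (s : ℝ) :
    ‖(s : ℂ) * u + v‖ ^ 2 - ‖(s : ℂ) * u - v‖ ^ 2 = 4 * s * (u.re * v.re + u.im * v.im) := by
  rw [Complex.sq_norm, Complex.sq_norm, Complex.normSq_apply, Complex.normSq_apply]
  simp
  ring

lemma seg (r γ : ℝ) (hr : 0 < r) (lam : ℂ) (hl : lam.re = γ) (a : ℝ)
    (W W' : ℝ → (Fin 2 → ℂ))
    (h1 : ∀ x ∈ Icc a (a + 1), HasDerivWithinAt W (W' x) (Icc a (a + 1)) x)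
    (h2 : ∀ x ∈ Icc a (a + 1), lam • W x =
              (!![0, 1; (r : ℂ), 0] : Matrix (Fin 2) (Fin 2) ℂ).mulVec (W' x))
    (h3 : (W (a + 1) 0).re * (W (a + 1) 1).re + (W (a + 1) 0).im * (W (a + 1) 1).im ≤ 0) :
    ‖((√r : ℝ) : ℂ) * W a 0 + W a 1‖ ≤
      Real.exp (-(2 * γ / √r)) * ‖((√r : ℝ) : ℂ) * W a 0 - W a 1‖ := by
  set s : ℝ := √r with hs
  have hs0 : 0 < s := Real.sqrt_pos.2 hr
  have hsc : (s : ℂ) ≠ 0 := by exact_mod_cast hs0.ne'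
  have hrs : (r : ℂ) = s * s := by
    rw [← Complex.ofReal_mul, hs, Real.mul_self_sqrt hr.le]
  have e : ∀ x ∈ Icc a (a + 1), lam * W x 0 = W' x 1 ∧ lam * W x 1 = s * s * W' x 0 := by
    intro x hx
    have h := h2 x hx
    have h0 := congrFun h 0
    have h1 := congrFun h 1
    simp [Matrix.mulVec, dotProduct, Fin.sum_univ_two, hrs] at h0 h1
    exact ⟨h0, h1⟩
  have d : ∀ x ∈ Icc a (a + 1), ∀ i, HasDerivWithinAt (fun y => W y i) (W' x i)
      (Icc a (a + 1)) x := fun x hx i => (hasDerivWithinAt_pi.1 (h1 x hx)) i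
  have hp := exp_sol (fun y => (s : ℂ) * W y 0 + W y 1) (lam / s) a (by
    intro x hx
    refine (((d x hx 0).const_mul (s : ℂ)).add (d x hx 1)).congr_deriv ?_
    obtain ⟨e0, e1⟩ := e x hx
    rw [← e0]
    field_simp
    linear_combination -e1)
  have hq := exp_sol (fun y => (s : ℂ) * W y 0 - W y 1) (-(lam / s)) a (by
    intro x hx
    refine (((d x hx 0).const_mul (s : ℂ)).sub (d x hx 1)).congr_deriv ?_
    obtain ⟨e0, e1⟩ := e x hx
    rw [← e0]
    field_simp
    linear_combination -e1)
  have hle : ‖(s : ℂ) * W (a + 1) 0 + W (a + 1) 1‖ ≤ ‖(s : ℂ) * W (a + 1) 0 - W (a + 1) 1‖ := by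
    have := sq_diff (W (a + 1) 0) (W (a + 1) 1) s
    apply le_of_sq_le_sq _ (norm_nonneg _)
    nlinarith
  have hre : (lam / (s : ℂ)).re = γ / s := by rw [Complex.div_ofReal_re, hl]
  rw [hp, hq, norm_mul, norm_mul, Complex.norm_exp, Complex.norm_exp, Complex.neg_re, hre] at hle
  have hE : Real.exp (-(2 * γ / s)) = Real.exp (-(γ / s)) * Real.exp (-(γ / s)) := by
    rw [← Real.exp_add]; congr 1; ring
  have := mul_le_mul_of_nonneg_left hle (Real.exp_pos (-(γ / s))).le
  rw [← mul_assoc, ← mul_assoc, ← Real.exp_add, neg_add_cancel, Real.exp_zero, one_mul] at this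
  rw [hE]
  exact this

/-- boundedness of the transfer function on the line `Re λ = γ > 0`: there is
`c_γ > 0` such that for every `λ` with `Re λ = γ`, every `z ∈ ℂ` and every C¹ solution
`W = (W₀, …, W_{N−1})` of `λ W_j = B(ρ_j) W_j'` on `[j, j+1]` (with `B(ρ) = !![0, 1; ρ, 0]`),
satisfying the transmission conditions `W_{j−1}(j) = W_j(j)`, the input condition
`(W₀(0))₂ = z` and the output-end condition `(W_{N−1}(N))₁ = 0`, one has
`|(W₀(0))₁| ≤ c_γ |z|`. -/
theorem stmt12 (N : ℕ) (hN : 1 ≤ N) (ρ : ℕ → ℝ) (hρ : ∀ j < N, 0 < ρ j)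
    (γ : ℝ) (hγ : 0 < γ) :
    ∃ cγ : ℝ, 0 < cγ ∧
      ∀ (lam : ℂ), lam.re = γ →
        ∀ (z : ℂ) (W W' : ℕ → ℝ → (Fin 2 → ℂ)),
          (∀ j < N, ∀ x ∈ Icc (j : ℝ) (j + 1),
            HasDerivWithinAt (W j) (W' j x) (Icc (j : ℝ) (j + 1)) x) →
          (∀ j < N, ContinuousOn (W' j) (Icc (j : ℝ) (j + 1))) →
          (∀ j < N, ∀ x ∈ Icc (j : ℝ) (j + 1),
            lam • W j x =
              (!![0, 1; (ρ j : ℂ), 0] : Matrix (Fin 2) (Fin 2) ℂ).mulVec (W' j x)) →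
          (∀ j, 1 ≤ j → j ≤ N - 1 → W (j - 1) j = W j j) →
          (W 0 0 1 = z) →
          (W (N - 1) N 0 = 0) →
          ‖W 0 0 0‖ ≤ cγ * ‖z‖ := by
  have hr0 := hρ 0 hN
  set s : ℝ := √(ρ 0) with hs
  have hs0 : 0 < s := Real.sqrt_pos.2 hr0
  set k : ℝ := Real.exp (-(2 * γ / s)) with hk
  have hk0 : 0 < k := Real.exp_pos _
  have hk1 : k < 1 := by
    rw [hk, Real.exp_lt_one_iff]
    have : 0 < 2 * γ / s := by positivity
    linarith
  have hden : 0 < s * (1 - k) := mul_pos hs0 (by linarith)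
  refine ⟨(1 + k) / (s * (1 - k)), by positivity, ?_⟩
  intro lam hl z W W' h1 _ h2 h3 h4 h5
  have key : ∀ i j : ℕ, j + 1 + i = N →
      (W j ((j : ℝ) + 1) 0).re * (W j ((j : ℝ) + 1) 1).re
        + (W j ((j : ℝ) + 1) 0).im * (W j ((j : ℝ) + 1) 1).im ≤ 0 := by
    intro i
    induction i with
    | zero =>
      intro j hj
      subst hj
      simp at h5
      simp [h5]
    | succ i ih =>
      intro j hj
      have ih' := ih (j + 1) (by omega)
      have hj1 : j + 1 < N := by omega
      have hr := hρ (j + 1) hj1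
      have hseg := seg (ρ (j + 1)) γ hr lam hl ((j + 1 : ℕ) : ℝ) (W (j + 1)) (W' (j + 1))
        (h1 _ hj1) (h2 _ hj1) ih'
      have ht := h3 (j + 1) (by omega) (by omega)
      simp only [Nat.add_sub_cancel] at ht
      rw [← ht] at hseg
      push_cast at hseg
      have hsj : 0 < √(ρ (j + 1)) := Real.sqrt_pos.2 hr
      have hkj : Real.exp (-(2 * γ / √(ρ (j + 1)))) ≤ 1 := by
        rw [Real.exp_le_one_iff]
        have : 0 < 2 * γ / √(ρ (j + 1)) := by positivity
        linarith
      have hle := hseg.trans (mul_le_of_le_one_left (norm_nonneg _) hkj)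
      have hd := sq_diff (W j ((j : ℝ) + 1) 0) (W j ((j : ℝ) + 1) 1) (√(ρ (j + 1)))
      have hsq := pow_le_pow_left₀ (norm_nonneg _) hle 2
      by_contra hc
      push Not at hc
      have : 0 < 4 * √(ρ (j + 1)) * ((W j ((j : ℝ) + 1) 0).re * (W j ((j : ℝ) + 1) 1).re
        + (W j ((j : ℝ) + 1) 0).im * (W j ((j : ℝ) + 1) 1).im) := by positivity
      linarith
  have h0 := seg (ρ 0) γ hr0 lam hl ((0 : ℕ) : ℝ) (W 0) (W' 0) (h1 0 hN) (h2 0 hN)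
    (key (N - 1) 0 (by omega))
  rw [← hs, ← hk, Nat.cast_zero, h4] at h0
  have a1 : ‖(s : ℂ) * W 0 0 0‖ = s * ‖W 0 0 0‖ := by
    rw [norm_mul, Complex.norm_real, Real.norm_of_nonneg hs0.le]
  have a2 := norm_sub_le ((s : ℂ) * W 0 0 0) z
  have a3 := norm_sub_le ((s : ℂ) * W 0 0 0 + z) z
  rw [add_sub_cancel_right] at a3
  have a4 := mul_le_mul_of_nonneg_left a2 hk0.le
  rw [a1] at a3 a4
  rw [div_mul_eq_mul_div, le_div_iff₀ hden]
  nlinarith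
end

section
/- Let N ≥ 1 and ρ₀, …, ρ_{N−1} > 0. Suppose u₀, …, u_{N−1} with u_j : [j, j+1] → ℂ twice continuously differentiable satisfy: ρ₀·u₀'(0) = i·u₀(0); u_{N−1}(N) = 0; the continuity conditions u_{j−1}(j) = u_j(j) for j = 1, …, N−1; and the flux conditions ρ_{j−1}·u_{j−1}'(j) = ρ_j·u_j'(j) for j = 1, …, N−1. Then Re( Σ_{j=0}^{N−1} ∫_j^{j+1} ( −i·ρ_j·u_j''(x) )·conj(u_j(x)) dx ) = −|u₀(0)|². -/
open Complex Set

lemma aux_string_s13 (a : ℝ) (r : ℝ) (u u' u'' : ℝ → ℂ)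
    (hu1 : ∀ x ∈ Icc a (a + 1), HasDerivWithinAt u (u' x) (Icc a (a + 1)) x)
    (hu2 : ∀ x ∈ Icc a (a + 1), HasDerivWithinAt u' (u'' x) (Icc a (a + 1)) x)
    (hc : ContinuousOn u'' (Icc a (a + 1))) :
    (∫ x in a..(a + 1), (-Complex.I * (r : ℂ) * u'' x) * (starRingEnd ℂ) (u x)).re =
      (-Complex.I * ((r : ℂ) * u' (a + 1)) * (starRingEnd ℂ) (u (a + 1))).re -
      (-Complex.I * ((r : ℂ) * u' a) * (starRingEnd ℂ) (u a)).re := by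
  have hle : a ≤ a + 1 := by linarith
  have cu : ContinuousOn u (Icc a (a + 1)) := fun x hx => (hu1 x hx).continuousWithinAt
  have cu' : ContinuousOn u' (Icc a (a + 1)) := fun x hx => (hu2 x hx).continuousWithinAt
  have cs : ContinuousOn (fun x => (starRingEnd ℂ) (u x)) (Icc a (a + 1)) :=
    Complex.continuous_conj.comp_continuousOn cu
  have cF : ContinuousOn (fun x => (-Complex.I * (r : ℂ) * u'' x) * (starRingEnd ℂ) (u x))
      (Icc a (a + 1)) := (continuousOn_const.mul hc).mul cs
  have cG : ContinuousOn (fun x => -Complex.I * ((r : ℂ) * u' x) * (starRingEnd ℂ) (u x))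
      (Icc a (a + 1)) := (continuousOn_const.mul (continuousOn_const.mul cu')).mul cs
  have iF := cF.intervalIntegrable_of_Icc (μ := MeasureTheory.volume) hle
  have h1 := Complex.reCLM.intervalIntegral_comp_comm iF
  simp only [Complex.reCLM_apply] at h1
  rw [← h1]
  refine intervalIntegral.integral_eq_sub_of_hasDerivAt_of_le
    (f := fun x => (-Complex.I * ((r : ℂ) * u' x) * (starRingEnd ℂ) (u x)).re) hle
    (Complex.continuous_re.comp_continuousOn cG) ?_
    ((Complex.continuous_re.comp_continuousOn cF).intervalIntegrable_of_Icc hle)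
  intro x hx
  have hn : Icc a (a + 1) ∈ nhds x := Icc_mem_nhds hx.1 hx.2
  have d1 := (hu1 x (Ioo_subset_Icc_self hx)).hasDerivAt hn
  have d2 := (hu2 x (Ioo_subset_Icc_self hx)).hasDerivAt hn
  have ds : HasDerivAt (fun y => (starRingEnd ℂ) (u y)) ((starRingEnd ℂ) (u' x)) x :=
    d1.star
  have dG := ((d2.const_mul (r : ℂ)).const_mul (-Complex.I)).mul ds
  have dR := Complex.reCLM.hasFDerivAt.comp_hasDerivAt x dG
  refine (dR.congr_deriv ?_)
  simp [Complex.mul_re, Complex.mul_im]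
  ring

/-- dissipativity of the Schrödinger operator:
`Re Σ_j ∫_j^{j+1} (−i ρ_j u_j'') conj u_j = −|u₀(0)|²` under `ρ₀ u₀'(0) = i u₀(0)`,
`u_{N−1}(N) = 0`, the continuity conditions `u_{j−1}(j) = u_j(j)` and the flux conditions
`ρ_{j−1} u_{j−1}'(j) = ρ_j u_j'(j)`.  (`u' j`, `u'' j` are the first and second derivatives
of `u j` on `[j, j+1]`.) -/
theorem stmt13 (N : ℕ) (hN : 1 ≤ N) (ρ : ℕ → ℝ) (hρ : ∀ j < N, 0 < ρ j)
    (u u' u'' : ℕ → ℝ → ℂ)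
    (hu1 : ∀ j < N, ∀ x ∈ Icc (j : ℝ) (j + 1),
      HasDerivWithinAt (u j) (u' j x) (Icc (j : ℝ) (j + 1)) x)
    (hu2 : ∀ j < N, ∀ x ∈ Icc (j : ℝ) (j + 1),
      HasDerivWithinAt (u' j) (u'' j x) (Icc (j : ℝ) (j + 1)) x)
    (hu2c : ∀ j < N, ContinuousOn (u'' j) (Icc (j : ℝ) (j + 1)))
    (hbc0 : (ρ 0 : ℂ) * u' 0 0 = Complex.I * u 0 0)
    (hbcN : u (N - 1) N = 0)
    (hcont_node : ∀ j, 1 ≤ j → j ≤ N - 1 → u (j - 1) j = u j j)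
    (hflux : ∀ j, 1 ≤ j → j ≤ N - 1 → (ρ (j - 1) : ℂ) * u' (j - 1) j = (ρ j : ℂ) * u' j j) :
    (∑ j ∈ Finset.range N, ∫ x in (j : ℝ)..(j + 1),
        (-Complex.I * (ρ j : ℂ) * u'' j x) * (starRingEnd ℂ) (u j x)).re = -‖u 0 0‖ ^ 2 := by
  have key : ∀ j ∈ Finset.range N, (∫ x in (j : ℝ)..(j + 1),
        (-Complex.I * (ρ j : ℂ) * u'' j x) * (starRingEnd ℂ) (u j x)).re =
      (fun k : ℕ => if k < N then
        (-Complex.I * ((ρ k : ℂ) * u' k k) * (starRingEnd ℂ) (u k k)).re else 0) (j + 1) -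
      (fun k : ℕ => if k < N then
        (-Complex.I * ((ρ k : ℂ) * u' k k) * (starRingEnd ℂ) (u k k)).re else 0) j := by
    intro j hj
    have hj' := Finset.mem_range.1 hj
    rw [aux_string_s13 j (ρ j) (u j) (u' j) (u'' j) (hu1 j hj') (hu2 j hj') (hu2c j hj')]
    simp only [if_pos hj']
    congr 1
    split_ifs with h
    · have a1 := hcont_node (j + 1) (by omega) (by omega)
      have a2 := hflux (j + 1) (by omega) (by omega)
      simp only [Nat.add_sub_cancel] at a1 a2
      rw [← a1, ← a2]
      push_cast
      rfl
    · have e : N = j + 1 := by omega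
      subst e
      simp only [Nat.add_sub_cancel, Nat.cast_add, Nat.cast_one] at hbcN
      rw [hbcN]
      simp
  rw [Complex.re_sum, Finset.sum_congr rfl key, Finset.sum_range_sub (fun k : ℕ => if k < N then
        (-Complex.I * ((ρ k : ℂ) * u' k k) * (starRingEnd ℂ) (u k k)).re else 0)]
  have h0 : 0 < N := hN
  simp only [lt_irrefl, if_false, if_pos h0, Nat.cast_zero]
  rw [hbc0, ← mul_assoc, neg_mul, Complex.I_mul_I, neg_neg, one_mul, Complex.mul_conj,
    Complex.ofReal_re, Complex.normSq_eq_norm_sq]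
  ring
end

section
/- Let N ≥ 1 and ρ₀, …, ρ_{N−1} > 0. Suppose p₀, …, p_{N−1} are affine functions p_j : [j, j+1] → ℂ (that is, p_j(x) = a_j·x + b_j with a_j, b_j ∈ ℂ) satisfying: ρ₀·p₀'(0) = i·p₀(0); p_{N−1}(N) = 0; the continuity conditions p_{j−1}(j) = p_j(j) for j = 1, …, N−1; and the flux conditions ρ_{j−1}·p_{j−1}'(j) = ρ_j·p_j'(j) for j = 1, …, N−1. Then p_j ≡ 0 for every j = 0, …, N−1. -/
open Complex

/-- if the affine functions `p_j(x) = a_j x + b_j` satisfy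
`ρ₀ p₀'(0) = i p₀(0)`, `p_{N−1}(N) = 0`, the continuity conditions `p_{j−1}(j) = p_j(j)`
and the flux conditions `ρ_{j−1} p_{j−1}'(j) = ρ_j p_j'(j)`, then every `p_j` vanishes
identically. -/
theorem stmt15 (N : ℕ) (hN : 1 ≤ N) (ρ : ℕ → ℝ) (hρ : ∀ j < N, 0 < ρ j)
    (a b : ℕ → ℂ) (p : ℕ → ℝ → ℂ)
    (hp : ∀ j < N, ∀ x : ℝ, p j x = a j * (x : ℂ) + b j)
    (hbc0 : (ρ 0 : ℂ) * a 0 = Complex.I * p 0 0)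
    (hbcN : p (N - 1) N = 0)
    (hcont_node : ∀ j, 1 ≤ j → j ≤ N - 1 → p (j - 1) j = p j j)
    (hflux : ∀ j, 1 ≤ j → j ≤ N - 1 → (ρ (j - 1) : ℂ) * a (j - 1) = (ρ j : ℂ) * a j) :
    ∀ j < N, ∀ x : ℝ, p j x = 0 := by
  have key : ∀ j < N, (ρ j : ℂ) * a j = (ρ 0 : ℂ) * a 0 ∧
      ∃ s : ℝ, p j ((j : ℝ) + 1) = (ρ 0 : ℂ) * a 0 * ((s : ℂ) - Complex.I) := by
    intro j
    induction j with
    | zero =>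
      intro h
      refine ⟨rfl, (ρ 0)⁻¹, ?_⟩
      have h0 : (ρ 0 : ℂ) ≠ 0 := by exact_mod_cast (hρ 0 h).ne'
      have e0 := hp 0 h 0
      have e1 := hp 0 h ((0 : ℕ) + 1)
      have e2 : p 0 0 = -Complex.I * ((ρ 0 : ℂ) * a 0) := by
        rw [hbc0]
        linear_combination (p 0 0) * Complex.I_mul_I
      rw [e1]
      push_cast at e0 ⊢
      have e3 : (ρ 0 : ℂ) * (ρ 0 : ℂ)⁻¹ = 1 := mul_inv_cancel₀ h0
      linear_combination e2 - e0 - a 0 * e3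
    | succ k ih =>
      intro h
      obtain ⟨h1, s, hs⟩ := ih (by omega)
      have hf := hflux (k + 1) (by omega) (by omega)
      have hc := hcont_node (k + 1) (by omega) (by omega)
      simp only [Nat.add_sub_cancel] at hf hc
      have hr : (ρ (k + 1) : ℂ) * a (k + 1) = (ρ 0 : ℂ) * a 0 := by rw [← hf, h1]
      refine ⟨hr, s + (ρ (k + 1))⁻¹, ?_⟩
      have h0 : (ρ (k + 1) : ℂ) ≠ 0 := by exact_mod_cast (hρ _ h).ne'
      have e3 : (ρ (k + 1) : ℂ) * (ρ (k + 1) : ℂ)⁻¹ = 1 := mul_inv_cancel₀ h0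
      have e1 := hp (k + 1) h (((k + 1 : ℕ) : ℝ) + 1)
      have e2 := hp (k + 1) h ((k + 1 : ℕ) : ℝ)
      rw [← hc] at e2
      push_cast at e1 e2 ⊢
      rw [hs] at e2
      rw [e1]
      linear_combination -e2 - a (k + 1) * e3 + (ρ (k + 1) : ℂ)⁻¹ * hr
  have hc0 : (ρ 0 : ℂ) * a 0 = 0 := by
    obtain ⟨_, s, hs⟩ := key (N - 1) (by omega)
    have hcast : ((N - 1 : ℕ) : ℝ) + 1 = N := by
      have : N - 1 + 1 = N := by omega
      exact_mod_cast this
    rw [hcast, hbcN] at hs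
    rcases mul_eq_zero.mp hs.symm with h | h
    · exact h
    · have := congrArg Complex.im h
      simp at this
  intro j hj x
  obtain ⟨h1, s, hs⟩ := key j hj
  have h0 : (ρ j : ℂ) ≠ 0 := by exact_mod_cast (hρ _ hj).ne'
  rw [hc0] at h1 hs
  have ha : a j = 0 := (mul_eq_zero.mp h1).resolve_left h0
  have e := hp j hj ((j : ℝ) + 1)
  rw [hs, ha] at e
  rw [hp j hj x, ha]
  linear_combination -e
end

section
/- Let N ≥ 1, ρ₀, …, ρ_{N−1} > 0 and β ∈ ℝ. Suppose u₀, …, u_{N−1} with u_j : [j, j+1] → ℂ twice continuously differentiable satisfy: ρ_j·u_j''(x) + β·u_j(x) = 0 on [j, j+1] for each j; u₀(0) = 0; ρ₀·u₀'(0) = i·u₀(0); u_{N−1}(N) = 0; the continuity conditions u_{j−1}(j) = u_j(j) for j = 1, …, N−1; and the flux conditions ρ_{j−1}·u_{j−1}'(j) = ρ_j·u_j'(j) for j = 1, …, N−1. Then u_j ≡ 0 on [j, j+1] for every j = 0, …, N−1. -/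
open Complex Set

lemma ode_zero (a b : ℝ) (c : ℂ) (f f' f'' : ℝ → ℂ)
    (h1 : ∀ x ∈ Icc a b, HasDerivWithinAt f (f' x) (Icc a b) x)
    (h2 : ∀ x ∈ Icc a b, HasDerivWithinAt f' (f'' x) (Icc a b) x)
    (h : ∀ x ∈ Icc a b, f'' x = c * f x) (ha : f a = 0) (ha' : f' a = 0) :
    ∀ x ∈ Icc a b, f x = 0 ∧ f' x = 0 := by
  let L : ℂ × ℂ →L[ℂ] ℂ × ℂ :=
    (ContinuousLinearMap.snd ℂ ℂ ℂ).prod (c • ContinuousLinearMap.fst ℂ ℂ ℂ)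
  have key : EqOn (fun x => (f x, f' x)) (fun _ => (0 : ℂ × ℂ)) (Icc a b) := by
    apply ODE_solution_unique (v := fun _ p => L p) (K := ‖L‖₊)
    · intro _
      exact L.lipschitz
    · exact ContinuousOn.prodMk (fun x hx => (h1 x hx).continuousWithinAt)
        (fun x hx => (h2 x hx).continuousWithinAt)
    · intro t ht
      have ht' := Ico_subset_Icc_self ht
      have := (h1 t ht').prodMk (h2 t ht')
      rw [h t ht'] at this
      exact this.mono_of_mem_nhdsWithin (Icc_mem_nhdsGE_of_mem ht)
    · exact continuousOn_const
    · intro t ht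
      simpa using hasDerivWithinAt_const t (Ici t) (0 : ℂ × ℂ)
    · simp [ha, ha']
  intro x hx
  simpa [Prod.ext_iff] using key hx

/-- if `u_j : [j, j+1] → ℂ` are C² and satisfy `ρ_j u_j'' + β u_j = 0`,
`u₀(0) = 0`, `ρ₀ u₀'(0) = i u₀(0)`, `u_{N−1}(N) = 0`, the continuity conditions
`u_{j−1}(j) = u_j(j)` and the flux conditions `ρ_{j−1} u_{j−1}'(j) = ρ_j u_j'(j)`,
then every `u_j` vanishes identically on `[j, j+1]`. -/
theorem stmt16 (N : ℕ) (hN : 1 ≤ N) (ρ : ℕ → ℝ) (hρ : ∀ j < N, 0 < ρ j) (β : ℝ)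
    (u u' u'' : ℕ → ℝ → ℂ)
    (hu1 : ∀ j < N, ∀ x ∈ Icc (j : ℝ) (j + 1),
      HasDerivWithinAt (u j) (u' j x) (Icc (j : ℝ) (j + 1)) x)
    (hu2 : ∀ j < N, ∀ x ∈ Icc (j : ℝ) (j + 1),
      HasDerivWithinAt (u' j) (u'' j x) (Icc (j : ℝ) (j + 1)) x)
    (hu2c : ∀ j < N, ContinuousOn (u'' j) (Icc (j : ℝ) (j + 1)))
    (hode : ∀ j < N, ∀ x ∈ Icc (j : ℝ) (j + 1),
      (ρ j : ℂ) * u'' j x + (β : ℂ) * u j x = 0)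
    (hu00 : u 0 0 = 0)
    (hbc0 : (ρ 0 : ℂ) * u' 0 0 = Complex.I * u 0 0)
    (hbcN : u (N - 1) N = 0)
    (hcont_node : ∀ j, 1 ≤ j → j ≤ N - 1 → u (j - 1) j = u j j)
    (hflux : ∀ j, 1 ≤ j → j ≤ N - 1 → (ρ (j - 1) : ℂ) * u' (j - 1) j = (ρ j : ℂ) * u' j j) :
    ∀ j < N, ∀ x ∈ Icc (j : ℝ) (j + 1), u j x = 0 := by
  have step : ∀ j < N, u j j = 0 → u' j j = 0 →
      ∀ x ∈ Icc (j : ℝ) (j + 1), u j x = 0 ∧ u' j x = 0 := by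
    intro j hj h0 h0'
    refine ode_zero _ _ (-((β : ℂ) / ρ j)) (u j) (u' j) (u'' j) (hu1 j hj) (hu2 j hj) ?_ h0 h0'
    intro x hx
    have hne : (ρ j : ℂ) ≠ 0 := by exact_mod_cast (hρ j hj).ne'
    have := hode j hj x hx
    field_simp
    linear_combination this
  have all : ∀ j < N, ∀ x ∈ Icc (j : ℝ) (j + 1), u j x = 0 ∧ u' j x = 0 := by
    intro j
    induction j with
    | zero =>
      intro hj
      have hne : (ρ 0 : ℂ) ≠ 0 := by exact_mod_cast (hρ 0 hj).ne'
      apply step 0 hj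
      · simpa using hu00
      · rw [hu00, mul_zero] at hbc0
        simpa using (mul_eq_zero.mp hbc0).resolve_left hne
    | succ k ih =>
      intro hj
      have hne : (ρ (k + 1) : ℂ) ≠ 0 := by exact_mod_cast (hρ (k + 1) hj).ne'
      obtain ⟨e1, e2⟩ := ih (by omega) ((k + 1 : ℕ) : ℝ) (by push_cast; constructor <;> linarith)
      have c1 := hcont_node (k + 1) (by omega) (by omega)
      have c2 := hflux (k + 1) (by omega) (by omega)
      rw [Nat.add_sub_cancel] at c1 c2
      apply step (k + 1) hj
      · rw [← c1, e1]
      · rw [e2, mul_zero] at c2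
        exact (mul_eq_zero.mp c2.symm).resolve_left hne
  exact fun j hj x hx => (all j hj x hx).1
end

section
/- Let N ≥ 1, ρ₀, …, ρ_{N−1} > 0 and β < 0. Suppose g₀, …, g_{N−1} with g_j : [j, j+1] → ℂ continuous and u₀, …, u_{N−1} with u_j : [j, j+1] → ℂ twice continuously differentiable satisfy: i·β·u_j(x) + i·ρ_j·u_j''(x) = g_j(x) on [j, j+1] for each j; ρ₀·u₀'(0) = i·u₀(0); u_{N−1}(N) = 0; the continuity conditions u_{j−1}(j) = u_j(j) for j = 1, …, N−1; and the flux conditions ρ_{j−1}·u_{j−1}'(j) = ρ_j·u_j'(j) for j = 1, …, N−1. Then −β · Σ_{j=0}^{N−1} ∫_j^{j+1} |u_j(x)|² dx ≤ ( Σ_{j=0}^{N−1} ∫_j^{j+1} |u_j(x)|² dx )^{1/2} · ( Σ_{j=0}^{N−1} ∫_j^{j+1} |g_j(x)|² dx )^{1/2}. -/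
open Complex Set

lemma piece_bound (a ρ β : ℝ) (hρ : 0 < ρ) (hβ : β < 0) (g u u' u'' : ℝ → ℂ)
    (hg : ContinuousOn g (Icc a (a + 1)))
    (hu1 : ∀ x ∈ Icc a (a + 1), HasDerivWithinAt u (u' x) (Icc a (a + 1)) x)
    (hu2 : ∀ x ∈ Icc a (a + 1), HasDerivWithinAt u' (u'' x) (Icc a (a + 1)) x)
    (hu2c : ContinuousOn u'' (Icc a (a + 1)))
    (heq : ∀ x ∈ Icc a (a + 1),
      Complex.I * (β : ℂ) * u x + Complex.I * (ρ : ℂ) * u'' x = g x) :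
    β ^ 2 * (∫ x in a..(a + 1), ‖u x‖ ^ 2) - (∫ x in a..(a + 1), ‖g x‖ ^ 2) ≤
      (-2 * β) * (ρ * inner ℝ (u (a + 1)) (u' (a + 1)) - ρ * inner ℝ (u a) (u' a)) := by
  have hle : a ≤ a + 1 := by linarith
  have cu : ContinuousOn u (Icc a (a + 1)) := fun x hx => (hu1 x hx).continuousWithinAt
  have cu' : ContinuousOn u' (Icc a (a + 1)) := fun x hx => (hu2 x hx).continuousWithinAt
  have cF : ContinuousOn (fun x => ρ * (inner ℝ (u x) (u'' x) + inner ℝ (u' x) (u' x)))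
      (Icc a (a + 1)) := continuousOn_const.mul ((cu.inner hu2c).add (cu'.inner cu'))
  have key : ∫ x in a..(a + 1), ρ * (inner ℝ (u x) (u'' x) + inner ℝ (u' x) (u' x)) =
      ρ * inner ℝ (u (a + 1)) (u' (a + 1)) - ρ * inner ℝ (u a) (u' a) := by
    refine intervalIntegral.integral_eq_sub_of_hasDerivAt_of_le
      (f := fun x => ρ * inner ℝ (u x) (u' x)) hle
      (continuousOn_const.mul (cu.inner cu')) ?_ (cF.intervalIntegrable_of_Icc hle)
    intro x hx
    have hx' := Ioo_subset_Icc_self hx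
    exact ((HasDerivWithinAt.inner ℝ (hu1 x hx') (hu2 x hx')).const_mul ρ).hasDerivAt
      (Icc_mem_nhds hx.1 hx.2)
  rw [← key, ← intervalIntegral.integral_const_mul, ← intervalIntegral.integral_const_mul,
    ← intervalIntegral.integral_sub]
  · apply intervalIntegral.integral_mono_on hle
    · exact ((continuousOn_const.mul (cu.norm.pow 2)).sub
        (hg.norm.pow 2)).intervalIntegrable_of_Icc hle
    · exact (continuousOn_const.mul cF).intervalIntegrable_of_Icc hle
    · intro x hx
      rw [← heq x hx]
      simp only [← Complex.normSq_eq_norm_sq, Complex.normSq_apply, Complex.inner]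
      simp
      have h1 := mul_nonneg (mul_nonneg (neg_nonneg.2 hβ.le) hρ.le) (sq_nonneg (u' x).re)
      have h2 := mul_nonneg (mul_nonneg (neg_nonneg.2 hβ.le) hρ.le) (sq_nonneg (u' x).im)
      have h3 := sq_nonneg (ρ * (u'' x).re)
      have h4 := sq_nonneg (ρ * (u'' x).im)
      nlinarith
  · exact (continuousOn_const.mul (cu.norm.pow 2)).intervalIntegrable_of_Icc hle
  · exact (hg.norm.pow 2).intervalIntegrable_of_Icc hle

/-- a priori estimate for the resolvent equation of the Schrödinger operator
for `β < 0`: if `i β u_j + i ρ_j u_j'' = g_j` on `[j, j+1]` with `ρ₀ u₀'(0) = i u₀(0)`,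
`u_{N−1}(N) = 0`, continuity and flux conditions at the interior nodes, then
`−β Σ_j ∫_j^{j+1} |u_j|² ≤ (Σ_j ∫_j^{j+1} |u_j|²)^{1/2} (Σ_j ∫_j^{j+1} |g_j|²)^{1/2}`. -/
theorem stmt17 (N : ℕ) (hN : 1 ≤ N) (ρ : ℕ → ℝ) (hρ : ∀ j < N, 0 < ρ j)
    (β : ℝ) (hβ : β < 0)
    (g u u' u'' : ℕ → ℝ → ℂ)
    (hg : ∀ j < N, ContinuousOn (g j) (Icc (j : ℝ) (j + 1)))
    (hu1 : ∀ j < N, ∀ x ∈ Icc (j : ℝ) (j + 1),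
      HasDerivWithinAt (u j) (u' j x) (Icc (j : ℝ) (j + 1)) x)
    (hu2 : ∀ j < N, ∀ x ∈ Icc (j : ℝ) (j + 1),
      HasDerivWithinAt (u' j) (u'' j x) (Icc (j : ℝ) (j + 1)) x)
    (hu2c : ∀ j < N, ContinuousOn (u'' j) (Icc (j : ℝ) (j + 1)))
    (heq : ∀ j < N, ∀ x ∈ Icc (j : ℝ) (j + 1),
      Complex.I * (β : ℂ) * u j x + Complex.I * (ρ j : ℂ) * u'' j x = g j x)
    (hbc0 : (ρ 0 : ℂ) * u' 0 0 = Complex.I * u 0 0)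
    (hbcN : u (N - 1) N = 0)
    (hcont_node : ∀ j, 1 ≤ j → j ≤ N - 1 → u (j - 1) j = u j j)
    (hflux : ∀ j, 1 ≤ j → j ≤ N - 1 → (ρ (j - 1) : ℂ) * u' (j - 1) j = (ρ j : ℂ) * u' j j) :
    -β * ∑ j ∈ Finset.range N, ∫ x in (j : ℝ)..(j + 1), ‖u j x‖ ^ 2 ≤
      Real.sqrt (∑ j ∈ Finset.range N, ∫ x in (j : ℝ)..(j + 1), ‖u j x‖ ^ 2) *
        Real.sqrt (∑ j ∈ Finset.range N, ∫ x in (j : ℝ)..(j + 1), ‖g j x‖ ^ 2) := by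
  set A := ∑ j ∈ Finset.range N, ∫ x in (j : ℝ)..(j + 1), ‖u j x‖ ^ 2 with hA
  set B := ∑ j ∈ Finset.range N, ∫ x in (j : ℝ)..(j + 1), ‖g j x‖ ^ 2 with hB
  have hA0 : 0 ≤ A := Finset.sum_nonneg fun j _ =>
    intervalIntegral.integral_nonneg (by linarith) fun x _ => by positivity
  let G : ℕ → ℝ := fun j => if j < N then ρ j * inner ℝ (u j j) (u' j j) else 0
  have hG : ∀ j < N, ρ j * inner ℝ (u j ((j : ℝ) + 1)) (u' j ((j : ℝ) + 1)) = G (j + 1) := by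
    intro j hj
    by_cases h : j + 1 < N
    · have h1 := hcont_node (j + 1) (by omega) (by omega)
      have h2 := hflux (j + 1) (by omega) (by omega)
      simp only [Nat.add_sub_cancel, Nat.cast_add, Nat.cast_one] at h1 h2
      simp only [G, h, if_true, Nat.cast_add, Nat.cast_one]
      rw [← h1, ← real_inner_smul_right, ← real_inner_smul_right, Complex.real_smul,
        Complex.real_smul, h2]
    · have h1 : N = j + 1 := by omega
      subst h1
      simp only [Nat.add_sub_cancel, Nat.cast_add, Nat.cast_one] at hbcN
      simp [G, hbcN]
  have hG0 : G 0 = 0 := by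
    have : 0 < N := hN
    simp only [G, this, if_true, Nat.cast_zero]
    rw [← real_inner_smul_right, Complex.real_smul, hbc0, Complex.inner]
    simp
    ring
  have hGN : G N = 0 := by simp [G]
  have hsum : β ^ 2 * A - B ≤ 0 := by
    have : β ^ 2 * A - B ≤ ∑ j ∈ Finset.range N, (-2 * β) * (G (j + 1) - G j) := by
      rw [hA, hB, Finset.mul_sum, ← Finset.sum_sub_distrib]
      apply Finset.sum_le_sum
      intro j hj
      have hj := Finset.mem_range.1 hj
      have := piece_bound j (ρ j) β (hρ j hj) hβ (g j) (u j) (u' j) (u'' j) (hg j hj) (hu1 j hj)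
        (hu2 j hj) (hu2c j hj) (heq j hj)
      rw [hG j hj] at this
      simpa [G, hj] using this
    rwa [← Finset.mul_sum, Finset.sum_range_sub, hG0, hGN, sub_zero, mul_zero] at this
  have h1 : -β * Real.sqrt A ≤ Real.sqrt B := by
    apply Real.le_sqrt_of_sq_le
    rw [mul_pow, Real.sq_sqrt hA0]
    linarith
  have h2 := mul_le_mul_of_nonneg_left h1 (Real.sqrt_nonneg A)
  have h3 := Real.mul_self_sqrt hA0
  calc -β * A = Real.sqrt A * (-β * Real.sqrt A) := by rw [← h3]; simp only [h3]; linear_combination β * h3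
    _ ≤ _ := h2
end

section
/- Let N ≥ 1 and ρ₀, …, ρ_{N−1} > 0. There exist constants C > 0 and β₀ > 0, depending only on N and ρ₀, …, ρ_{N−1}, with the following property: for every β ≥ β₀, every family g₀, …, g_{N−1} of continuous functions g_j : [j, j+1] → ℂ, and every family u₀, …, u_{N−1} of twice continuously differentiable functions u_j : [j, j+1] → ℂ satisfying i·β·u_j(x) + i·ρ_j·u_j''(x) = g_j(x) on [j, j+1] for each j, the boundary conditions ρ₀·u₀'(0) = i·u₀(0) and u_{N−1}(N) = 0, the continuity conditions u_{j−1}(j) = u_j(j) for j = 1, …, N−1, and the flux conditions ρ_{j−1}·u_{j−1}'(j) = ρ_j·u_j'(j) for j = 1, …, N−1, one has Σ_{j=0}^{N−1} ∫_j^{j+1} |u_j(x)|² dx ≤ C · Σ_{j=0}^{N−1} ∫_j^{j+1} |g_j(x)|² dx. -/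
open Complex Set

lemma aux_cont {f : ℝ → ℂ} {f' : ℝ → ℂ} {a b : ℝ}
    (h : ∀ x ∈ Icc a b, HasDerivWithinAt f (f' x) (Icc a b) x) : ContinuousOn f (Icc a b) :=
  fun x hx => (h x hx).continuousWithinAt

lemma aux_normsq (z : ℂ) : ‖z‖ ^ 2 = z.re ^ 2 + z.im ^ 2 := by
  rw [← Complex.normSq_eq_norm_sq, Complex.normSq_apply]; ring

lemma aux_re_s18 {f : ℝ → ℂ} {d : ℂ} {x : ℝ} (h : HasDerivAt f d x) :
    HasDerivAt (fun t => (f t).re) d.re x := by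
  exact Complex.reCLM.hasFDerivAt.comp_hasDerivAt x h

lemma aux_im {f : ℝ → ℂ} {d : ℂ} {x : ℝ} (h : HasDerivAt f d x) :
    HasDerivAt (fun t => (f t).im) d.im x := by
  exact Complex.imCLM.hasFDerivAt.comp_hasDerivAt x h

lemma aux_E (a r β : ℝ) (hr : 0 < r) (hβ : 0 ≤ β) (g u u' u'' : ℝ → ℂ)
    (hg : ContinuousOn g (Icc a (a + 1)))
    (hu : ∀ x ∈ Icc a (a + 1), HasDerivWithinAt u (u' x) (Icc a (a + 1)) x)
    (hu' : ∀ x ∈ Icc a (a + 1), HasDerivWithinAt u' (u'' x) (Icc a (a + 1)) x)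
    (heq : ∀ x ∈ Icc a (a + 1), Complex.I * (β : ℂ) * u x + Complex.I * (r : ℂ) * u'' x = g x)
    (x : ℝ) (hx : x ∈ Icc a (a + 1)) :
    β * ‖u x‖ ^ 2 + r * ‖u' x‖ ^ 2 ≤
      3 * (β * ‖u a‖ ^ 2 + r * ‖u' a‖ ^ 2 + 1 / r * ∫ t in a..(a + 1), ‖g t‖ ^ 2) := by
  have cu := aux_cont hu
  have cu' := aux_cont hu'
  set E : ℝ → ℝ := fun t => β * ((u t).re ^ 2 + (u t).im ^ 2)
      + r * ((u' t).re ^ 2 + (u' t).im ^ 2) with hE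
  have hEe : ∀ t, β * ‖u t‖ ^ 2 + r * ‖u' t‖ ^ 2 = E t := by
    intro t; simp only [hE, aux_normsq]
  have hEn : ∀ t, 0 ≤ E t := fun t => by simp only [hE]; positivity
  have cE : ContinuousOn (fun t => Real.exp (a - t) * E t) (Icc a (a + 1)) := by
    have h1 := Complex.continuous_re.comp_continuousOn cu
    have h2 := Complex.continuous_im.comp_continuousOn cu
    have h3 := Complex.continuous_re.comp_continuousOn cu'
    have h4 := Complex.continuous_im.comp_continuousOn cu'
    simp only [Function.comp_def] at h1 h2 h3 h4
    simp only [hE]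
    fun_prop
  have cg : ContinuousOn (fun t => 1 / r * ‖g t‖ ^ 2) (Icc a (a + 1)) := by fun_prop
  have ig : ∀ c d, a ≤ c → c ≤ d → d ≤ a + 1 →
      IntervalIntegrable (fun t => 1 / r * ‖g t‖ ^ 2) MeasureTheory.volume c d := by
    intro c d h1 h2 h3
    apply ContinuousOn.intervalIntegrable
    rw [uIcc_of_le h2]
    exact cg.mono (Icc_subset_Icc h1 h3)
  have sub : Icc a x ⊆ Icc a (a + 1) := Icc_subset_Icc le_rfl hx.2
  have key : Real.exp (a - x) * E x - Real.exp (a - a) * E a ≤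
      ∫ t in a..x, 1 / r * ‖g t‖ ^ 2 := by
    refine intervalIntegral.sub_le_integral_of_hasDeriv_right_of_le hx.1 (cE.mono sub)
      (g' := fun t => Real.exp (a - t) * (-1) * E t + Real.exp (a - t) *
        (β * (2 * (u t).re * (u' t).re + 2 * (u t).im * (u' t).im)
         + r * (2 * (u' t).re * (u'' t).re + 2 * (u' t).im * (u'' t).im))) ?_ ?_ ?_
    · intro t ht
      have ht' : t ∈ Ioo a (a + 1) := ⟨ht.1, ht.2.trans_le hx.2⟩
      have nb : Icc a (a + 1) ∈ nhds t := Icc_mem_nhds ht'.1 ht'.2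
      have d1 := (hu t (Ioo_subset_Icc_self ht')).hasDerivAt nb
      have d2 := (hu' t (Ioo_subset_Icc_self ht')).hasDerivAt nb
      have de : HasDerivAt (fun t => Real.exp (a - t)) (Real.exp (a - t) * (-1)) t := by
        have := ((hasDerivAt_id t).const_sub a).exp
        simpa using this
      have dE : HasDerivAt E (β * (2 * (u t).re * (u' t).re + 2 * (u t).im * (u' t).im)
         + r * (2 * (u' t).re * (u'' t).re + 2 * (u' t).im * (u'' t).im)) t := by
        have := ((((aux_re_s18 d1).pow 2).add ((aux_im d1).pow 2)).const_mul β).add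
          ((((aux_re_s18 d2).pow 2).add ((aux_im d2).pow 2)).const_mul r)
        refine this.congr_deriv ?_
        norm_num
      exact (de.mul dE).hasDerivWithinAt
    · exact (cg.mono sub).integrableOn_Icc
    · intro t ht
      have ht' : t ∈ Icc a (a + 1) := ⟨ht.1.le, ht.2.le.trans hx.2⟩
      have h0 := heq t ht'
      have hre : (g t).re = -(β * (u t).im) - r * (u'' t).im := by
        rw [← h0]; simp; ring
      have him : (g t).im = β * (u t).re + r * (u'' t).re := by
        rw [← h0]; simp
      have e1 : Real.exp (a - t) ≤ 1 := Real.exp_le_one_iff.2 (by linarith [ht.1])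
      have e0 := Real.exp_pos (a - t)
      have main : -E t + (β * (2 * (u t).re * (u' t).re + 2 * (u t).im * (u' t).im)
         + r * (2 * (u' t).re * (u'' t).re + 2 * (u' t).im * (u'' t).im)) ≤ 1 / r * ‖g t‖ ^ 2 := by
        have s : (β * (2 * (u t).re * (u' t).re + 2 * (u t).im * (u' t).im)
         + r * (2 * (u' t).re * (u'' t).re + 2 * (u' t).im * (u'' t).im))
          = 2 * (u' t).re * (g t).im - 2 * (u' t).im * (g t).re := by
          rw [hre, him]; ring
        rw [s, aux_normsq]
        have q1 : 2 * (u' t).re * (g t).im ≤ r * (u' t).re ^ 2 + 1 / r * (g t).im ^ 2 := by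
          have : r * (u' t).re ^ 2 + 1 / r * (g t).im ^ 2 - 2 * (u' t).re * (g t).im
            = 1 / r * (r * (u' t).re - (g t).im) ^ 2 := by field_simp; ring
          have : 0 ≤ 1 / r * (r * (u' t).re - (g t).im) ^ 2 := by positivity
          linarith
        have q2 : - (2 * (u' t).im * (g t).re) ≤ r * (u' t).im ^ 2 + 1 / r * (g t).re ^ 2 := by
          have : r * (u' t).im ^ 2 + 1 / r * (g t).re ^ 2 + 2 * (u' t).im * (g t).re
            = 1 / r * (r * (u' t).im + (g t).re) ^ 2 := by field_simp; ring
          have : 0 ≤ 1 / r * (r * (u' t).im + (g t).re) ^ 2 := by positivity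
          linarith
        have q3 : 0 ≤ β * ((u t).re ^ 2 + (u t).im ^ 2) := by positivity
        simp only [hE]
        linarith
      have gn : 0 ≤ 1 / r * ‖g t‖ ^ 2 := by positivity
      calc _ = Real.exp (a - t) * (-E t + (β * (2 * (u t).re * (u' t).re + 2 * (u t).im * (u' t).im)
         + r * (2 * (u' t).re * (u'' t).re + 2 * (u' t).im * (u'' t).im))) := by ring
        _ ≤ Real.exp (a - t) * (1 / r * ‖g t‖ ^ 2) := by gcongr
        _ ≤ 1 * (1 / r * ‖g t‖ ^ 2) := by gcongr
        _ = _ := one_mul _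
  have mono : ∫ t in a..x, 1 / r * ‖g t‖ ^ 2 ≤ ∫ t in a..(a + 1), 1 / r * ‖g t‖ ^ 2 := by
    have hs := intervalIntegral.integral_add_adjacent_intervals
      (ig a x le_rfl hx.1 hx.2) (ig x (a + 1) hx.1 hx.2 le_rfl)
    have : 0 ≤ ∫ t in x..(a + 1), 1 / r * ‖g t‖ ^ 2 :=
      intervalIntegral.integral_nonneg hx.2 (fun t _ => by positivity)
    linarith
  rw [intervalIntegral.integral_const_mul] at mono
  rw [hEe, hEe]
  simp only [sub_self, Real.exp_zero, one_mul] at key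
  set G := ∫ t in a..(a + 1), ‖g t‖ ^ 2
  have k2 : Real.exp (a - x) * E x ≤ E a + 1 / r * G := by
    simp only [intervalIntegral.integral_const_mul] at key mono ⊢
    linarith
  have k3 : E x = Real.exp (x - a) * (Real.exp (a - x) * E x) := by
    rw [← mul_assoc, ← Real.exp_add]; simp
  have k4 : Real.exp (x - a) ≤ 3 :=
    (Real.exp_le_exp.2 (by linarith [hx.2])).trans (Real.exp_one_lt_d9.le.trans (by norm_num))
  have k5 : 0 ≤ Real.exp (a - x) * E x := mul_nonneg (Real.exp_pos _).le (hEn x)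
  rw [k3]
  exact mul_le_mul k4 k2 k5 (by norm_num)

lemma aux_F (a r β ε : ℝ) (hε : 0 < ε) (g u u' u'' : ℝ → ℂ)
    (hg : ContinuousOn g (Icc a (a + 1)))
    (hu : ∀ x ∈ Icc a (a + 1), HasDerivWithinAt u (u' x) (Icc a (a + 1)) x)
    (hu' : ∀ x ∈ Icc a (a + 1), HasDerivWithinAt u' (u'' x) (Icc a (a + 1)) x)
    (heq : ∀ x ∈ Icc a (a + 1), Complex.I * (β : ℂ) * u x + Complex.I * (r : ℂ) * u'' x = g x) :
    (r * u' (a + 1)).re * (u (a + 1)).im - (r * u' (a + 1)).im * (u (a + 1)).re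
      - ((r * u' a).re * (u a).im - (r * u' a).im * (u a).re) ≤
      ε * (∫ t in a..(a + 1), ‖u t‖ ^ 2) + 1 / (4 * ε) * ∫ t in a..(a + 1), ‖g t‖ ^ 2 := by
  have cu := aux_cont hu
  have cu' := aux_cont hu'
  have hle : a ≤ a + 1 := by linarith
  have c1 : ContinuousOn (fun t => ε * ‖u t‖ ^ 2) (Icc a (a + 1)) := by fun_prop
  have c2 : ContinuousOn (fun t => 1 / (4 * ε) * ‖g t‖ ^ 2) (Icc a (a + 1)) := by fun_prop
  have i1 := ContinuousOn.intervalIntegrable (μ := MeasureTheory.volume) (by rwa [uIcc_of_le hle] :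
    ContinuousOn (fun t => ε * ‖u t‖ ^ 2) (uIcc a (a + 1)))
  have i2 := ContinuousOn.intervalIntegrable (μ := MeasureTheory.volume) (by rwa [uIcc_of_le hle] :
    ContinuousOn (fun t => 1 / (4 * ε) * ‖g t‖ ^ 2) (uIcc a (a + 1)))
  rw [← intervalIntegral.integral_const_mul, ← intervalIntegral.integral_const_mul,
    ← intervalIntegral.integral_add i1 i2]
  have h1 := Complex.continuous_re.comp_continuousOn cu
  have h2 := Complex.continuous_im.comp_continuousOn cu
  have h3 := Complex.continuous_re.comp_continuousOn cu'
  have h4 := Complex.continuous_im.comp_continuousOn cu'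
  simp only [Function.comp_def] at h1 h2 h3 h4
  have key := intervalIntegral.sub_le_integral_of_hasDeriv_right_of_le hle
    (g := fun t => r * ((u' t).re * (u t).im - (u' t).im * (u t).re))
    (g' := fun t => r * (((u'' t).re * (u t).im + (u' t).re * (u' t).im)
      - ((u'' t).im * (u t).re + (u' t).im * (u' t).re)))
    (φ := fun t => ε * ‖u t‖ ^ 2 + 1 / (4 * ε) * ‖g t‖ ^ 2)
    (by fun_prop) ?_ (c1.add c2).integrableOn_Icc ?_
  · simp only [Complex.re_ofReal_mul, Complex.im_ofReal_mul]
    linarith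
  · intro t ht
    have nb : Icc a (a + 1) ∈ nhds t := Icc_mem_nhds ht.1 ht.2
    have d1 := (hu t (Ioo_subset_Icc_self ht)).hasDerivAt nb
    have d2 := (hu' t (Ioo_subset_Icc_self ht)).hasDerivAt nb
    exact ((((aux_re_s18 d2).mul (aux_im d1)).sub ((aux_im d2).mul (aux_re_s18 d1))).const_mul
      r).hasDerivWithinAt
  · intro t ht
    have h0 := heq t (Ioo_subset_Icc_self ht)
    have hre : (g t).re = -(β * (u t).im) - r * (u'' t).im := by
      rw [← h0]; simp; ring
    have him : (g t).im = β * (u t).re + r * (u'' t).re := by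
      rw [← h0]; simp
    have s : r * (((u'' t).re * (u t).im + (u' t).re * (u' t).im)
      - ((u'' t).im * (u t).re + (u' t).im * (u' t).re)) =
        (g t).re * (u t).re + (g t).im * (u t).im := by rw [hre, him]; ring
    have : ε * ‖u t‖ ^ 2 + 1 / (4 * ε) * ‖g t‖ ^ 2
        - ((g t).re * (u t).re + (g t).im * (u t).im) =
        1 / (4 * ε) * ((2 * ε * (u t).re - (g t).re) ^ 2 + (2 * ε * (u t).im - (g t).im) ^ 2) := by
      rw [aux_normsq, aux_normsq]; field_simp; ring
    have : 0 ≤ 1 / (4 * ε) *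
      ((2 * ε * (u t).re - (g t).re) ^ 2 + (2 * ε * (u t).im - (g t).im) ^ 2) := by positivity
    simp only [s]
    linarith

/-- uniform high-frequency resolvent estimate for the Schrödinger operator on
a chain of `N` strings: there exist `C > 0` and `β₀ > 0`, depending only on `N` and the
densities, such that for every `β ≥ β₀` and every solution `u` (C², with `g` continuous) of
`i β u_j + i ρ_j u_j'' = g_j` on `[j, j+1]` with the boundary conditions
`ρ₀ u₀'(0) = i u₀(0)`, `u_{N−1}(N) = 0`, and the continuity and flux conditions at the
interior nodes, one has `Σ_j ∫_j^{j+1} |u_j|² ≤ C Σ_j ∫_j^{j+1} |g_j|²`. -/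
theorem stmt18 (N : ℕ) (hN : 1 ≤ N) (ρ : ℕ → ℝ) (hρ : ∀ j < N, 0 < ρ j) :
    ∃ C β₀ : ℝ, 0 < C ∧ 0 < β₀ ∧
      ∀ (β : ℝ), β₀ ≤ β →
        ∀ (g u u' u'' : ℕ → ℝ → ℂ),
          (∀ j < N, ContinuousOn (g j) (Icc (j : ℝ) (j + 1))) →
          (∀ j < N, ∀ x ∈ Icc (j : ℝ) (j + 1),
            HasDerivWithinAt (u j) (u' j x) (Icc (j : ℝ) (j + 1)) x) →
          (∀ j < N, ∀ x ∈ Icc (j : ℝ) (j + 1),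
            HasDerivWithinAt (u' j) (u'' j x) (Icc (j : ℝ) (j + 1)) x) →
          (∀ j < N, ContinuousOn (u'' j) (Icc (j : ℝ) (j + 1))) →
          (∀ j < N, ∀ x ∈ Icc (j : ℝ) (j + 1),
            Complex.I * (β : ℂ) * u j x + Complex.I * (ρ j : ℂ) * u'' j x = g j x) →
          ((ρ 0 : ℂ) * u' 0 0 = Complex.I * u 0 0) →
          (u (N - 1) N = 0) →
          (∀ j, 1 ≤ j → j ≤ N - 1 → u (j - 1) j = u j j) →
          (∀ j, 1 ≤ j → j ≤ N - 1 →
            (ρ (j - 1) : ℂ) * u' (j - 1) j = (ρ j : ℂ) * u' j j) →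
          ∑ j ∈ Finset.range N, ∫ x in (j : ℝ)..(j + 1), ‖u j x‖ ^ 2 ≤
            C * ∑ j ∈ Finset.range N, ∫ x in (j : ℝ)..(j + 1), ‖g j x‖ ^ 2 := by
  classical
  set K : ℝ := 1 + ∑ j ∈ Finset.range N, (ρ j + 1 / ρ j) with hK
  have hterm : ∀ j ∈ Finset.range N, 0 ≤ ρ j + 1 / ρ j := fun j hj => by
    have := hρ j (Finset.mem_range.1 hj); positivity
  have hKj : ∀ j < N, ρ j ≤ K ∧ 1 / ρ j ≤ K := by
    intro j hj
    have h1 := Finset.single_le_sum hterm (Finset.mem_range.2 hj)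
    have h2 := hρ j hj
    have h3 : 0 < 1 / ρ j := by positivity
    constructor <;> linarith
  have hK1 : 1 ≤ K := by
    have := Finset.sum_nonneg hterm
    linarith
  set D : ℝ := 3 * (K * K * K) with hD
  have hKK : 1 ≤ K * K := by nlinarith
  have hKKK : K * K ≤ K * K * K := by nlinarith
  have hD1 : 1 ≤ D := by linarith
  set B : ℝ := N * D ^ N with hB
  have hNpos : (0 : ℝ) < N := by exact_mod_cast hN
  have hBpos : 0 < B := by positivity
  set P : ℝ := B * (1 + K) with hP
  have hPpos : 0 < P := by positivity
  refine ⟨P ^ 2 + 2 * B, 1, by positivity, one_pos, ?_⟩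
  intro β hβ g u u' u'' hg hu hu' _ heq hb0 hbN hcont hflux
  set U : ℕ → ℝ := fun j => ∫ x in (j : ℝ)..(j + 1), ‖u j x‖ ^ 2 with hU
  set G : ℕ → ℝ := fun j => ∫ x in (j : ℝ)..(j + 1), ‖g j x‖ ^ 2 with hG
  have hGn : ∀ j, 0 ≤ G j := fun j =>
    intervalIntegral.integral_nonneg (by linarith) (fun t _ => by positivity)
  set e : ℕ → ℝ := fun j => β * ‖u j j‖ ^ 2 + ρ j * ‖u' j j‖ ^ 2 with he
  have hEx : ∀ j < N, ∀ x ∈ Icc (j : ℝ) (j + 1),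
      β * ‖u j x‖ ^ 2 + ρ j * ‖u' j x‖ ^ 2 ≤ 3 * (e j + K * G j) := by
    intro j hj x hx
    have h := aux_E j (ρ j) β (hρ j hj) (by linarith) (g j) (u j) (u' j) (u'' j) (hg j hj)
      (hu j hj) (hu' j hj) (heq j hj) x hx
    have h2 := mul_le_mul_of_nonneg_right (hKj j hj).2 (hGn j)
    simp only [he]
    simp only [hG] at h2 ⊢
    linarith
  have hen : ∀ j < N, 0 ≤ e j := fun j hj => by
    have := hρ j hj
    have : 0 ≤ β := by linarith
    simp only [he]; positivity
  have hstep : ∀ j, j + 1 < N → e (j + 1) ≤ D * (e j + G j) := by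
    intro j hj
    have hj' : j < N := by omega
    have h1 := hEx j hj' (j + 1) ⟨by linarith, le_rfl⟩
    have c := hcont (j + 1) (by omega) (by omega)
    have f := hflux (j + 1) (by omega) (by omega)
    simp only [Nat.add_sub_cancel] at c f
    push_cast at c f
    have r0 := hρ j hj'
    have r1 := hρ (j + 1) hj
    have hn : ρ j * ‖u' j (j + 1)‖ = ρ (j + 1) * ‖u' (j + 1) (j + 1)‖ := by
      have := congrArg norm f
      simpa [abs_of_pos r0, abs_of_pos r1] using this
    have hE : e (j + 1) ≤ K * K * (β * ‖u j (j + 1)‖ ^ 2 + ρ j * ‖u' j (j + 1)‖ ^ 2) := by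
      simp only [he]; push_cast
      rw [← c]
      have a1 : ρ (j + 1) * ‖u' (j + 1) (j + 1)‖ ^ 2
          = (1 / ρ (j + 1) * ρ j) * (ρ j * ‖u' j (j + 1)‖ ^ 2) := by
        have : ‖u' (j + 1) (j + 1)‖ = ρ j * ‖u' j (j + 1)‖ / ρ (j + 1) := by
          rw [hn]; field_simp
        rw [this]; field_simp
      have a2 : 1 / ρ (j + 1) * ρ j ≤ K * K :=
        mul_le_mul (hKj _ hj).2 (hKj _ hj').1 r0.le (by linarith)
      have a3 : (1 / ρ (j + 1) * ρ j) * (ρ j * ‖u' j (j + 1)‖ ^ 2) ≤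
        K * K * (ρ j * ‖u' j (j + 1)‖ ^ 2) := by gcongr
      have a4 : 0 ≤ β * ‖u j (j + 1)‖ ^ 2 := by
        have : 0 ≤ β := by linarith
        positivity
      have a5 := mul_le_mul_of_nonneg_right hKK a4
      rw [a1]; linarith
    have b1 : e (j + 1) ≤ K * K * (3 * (e j + K * G j)) := hE.trans (by gcongr)
    have b2 := mul_le_mul_of_nonneg_right hKKK (hen j hj')
    calc _ ≤ _ := b1
      _ = 3 * (K * K * e j) + 3 * (K * K * K * G j) := by ring
      _ ≤ _ := by rw [hD]; linarith
  have hind : ∀ j < N, e j ≤ D ^ j * (e 0 + ∑ i ∈ Finset.range j, G i) := by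
    intro j
    induction j with
    | zero => intro _; simp
    | succ j ih =>
      intro hj
      have h1 := ih (by omega)
      have h2 : 1 ≤ D ^ j := one_le_pow₀ hD1
      have h3 := mul_le_mul_of_nonneg_right h2 (hGn j)
      calc _ ≤ _ := hstep j hj
        _ ≤ D * (D ^ j * (e 0 + ∑ i ∈ Finset.range j, G i) + D ^ j * G j) := by
          gcongr; linarith
        _ = _ := by rw [Finset.sum_range_succ, pow_succ]; ring
  set GT := ∑ j ∈ Finset.range N, G j with hGT
  set UT := ∑ j ∈ Finset.range N, U j with hUT
  have hGTn : 0 ≤ GT := Finset.sum_nonneg (fun j _ => hGn j)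
  have he0 := hen 0 (by omega)
  have hUj : ∀ j < N, β * U j ≤ D ^ N * (e 0 + GT) := by
    intro j hj
    have h1 := hind j hj
    have hs : ∑ i ∈ Finset.range (j + 1), G i ≤ GT :=
      Finset.sum_le_sum_of_subset_of_nonneg (Finset.range_subset_range.2 (by omega)) (fun i _ _ => hGn i)
    rw [Finset.sum_range_succ] at hs
    have h2 : 1 ≤ D ^ j := one_le_pow₀ hD1
    have h3 := mul_le_mul_of_nonneg_right h2 (hGn j)
    have h4 : ∀ x ∈ Icc (j : ℝ) (j + 1), β * ‖u j x‖ ^ 2 ≤ D ^ N * (e 0 + GT) := by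
      intro x hx
      have q := hEx j hj x hx
      have q0 : 0 ≤ ρ j * ‖u' j x‖ ^ 2 := by have := hρ j hj; positivity
      have q1 : e j ≤ K * K * K * e j := by
        have := mul_le_mul_of_nonneg_right (hKK.trans hKKK) (hen j hj); linarith
      have q2 : K * G j ≤ K * K * K * G j := by
        apply mul_le_mul_of_nonneg_right _ (hGn j); nlinarith
      calc _ ≤ D * (e j + G j) := by rw [hD]; linarith
        _ ≤ D * (D ^ j * (e 0 + GT)) := by
          gcongr
          have : D ^ j * (∑ i ∈ Finset.range j, G i + G j) ≤ D ^ j * GT := by gcongr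
          linarith
        _ = D ^ (j + 1) * (e 0 + GT) := by ring
        _ ≤ _ := by
          gcongr
          omega
    have cu := aux_cont (hu j hj)
    have hle : (j : ℝ) ≤ j + 1 := by linarith
    have ci : IntervalIntegrable (fun x => β * ‖u j x‖ ^ 2) MeasureTheory.volume (j : ℝ) (j + 1) := by
      apply ContinuousOn.intervalIntegrable
      rw [uIcc_of_le hle]
      fun_prop
    have := intervalIntegral.integral_mono_on hle ci
      (intervalIntegrable_const (c := D ^ N * (e 0 + GT))) h4
    rw [intervalIntegral.integral_const_mul, intervalIntegral.integral_const] at this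
    simpa using this
  have hUTb : β * UT ≤ B * (e 0 + GT) := by
    rw [hUT, Finset.mul_sum]
    calc _ ≤ ∑ j ∈ Finset.range N, D ^ N * (e 0 + GT) :=
        Finset.sum_le_sum (fun j hj => hUj j (Finset.mem_range.1 hj))
      _ = _ := by simp [hB]; ring
  -- the flux identity
  set ε : ℝ := 1 / (2 * P) with hε
  have hεpos : 0 < ε := by positivity
  have hFl : ∀ j < N,
      (ρ j * u' j (j + 1)).re * (u j (j + 1)).im - (ρ j * u' j (j + 1)).im * (u j (j + 1)).re
        ≤ ‖u 0 0‖ ^ 2 * (-1) + ∑ i ∈ Finset.range (j + 1), (ε * U i + 1 / (4 * ε) * G i) := by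
    intro j
    induction j with
    | zero =>
      intro hj
      have h := aux_F (0 : ℕ) (ρ 0) β ε hεpos (g 0) (u 0) (u' 0) (u'' 0) (hg 0 hj)
        (hu 0 hj) (hu' 0 hj) (heq 0 hj)
      simp only [Nat.cast_zero] at h
      rw [hb0] at h
      rw [Finset.sum_range_one, aux_normsq]
      simp only [hU, hG, Nat.cast_zero]
      simp only [Complex.I_mul_re, Complex.I_mul_im] at h
      linarith
    | succ j ih =>
      intro hj
      have h1 := ih (by omega)
      have h := aux_F (j + 1 : ℕ) (ρ (j + 1)) β ε hεpos (g (j + 1)) (u (j + 1)) (u' (j + 1))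
        (u'' (j + 1)) (hg _ hj) (hu _ hj) (hu' _ hj) (heq _ hj)
      have c := hcont (j + 1) (by omega) (by omega)
      have f := hflux (j + 1) (by omega) (by omega)
      rw [← c, ← f] at h
      simp only [Nat.add_sub_cancel] at h
      rw [Finset.sum_range_succ]
      simp only [hU, hG] at h1 ⊢
      push_cast at h h1 ⊢
      linarith
  have hu0 : ‖u 0 0‖ ^ 2 ≤ ε * UT + 1 / (4 * ε) * GT := by
    have h := hFl (N - 1) (by omega)
    have hc : ((N - 1 : ℕ) : ℝ) + 1 = N := by
      have : (N - 1) + 1 = N := by omega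
      exact_mod_cast this
    rw [hc, hbN, Nat.sub_add_cancel hN, Finset.sum_add_distrib, ← Finset.mul_sum,
      ← Finset.mul_sum] at h
    simp only [Complex.zero_re, Complex.zero_im] at h
    linarith
  have he0b : e 0 ≤ β * ((1 + K) * ‖u 0 0‖ ^ 2) := by
    have r0 := hρ 0 (by omega)
    have hn : ρ 0 * ‖u' 0 0‖ = ‖u 0 0‖ := by
      have := congrArg norm hb0
      simpa [abs_of_pos r0] using this
    have h1 : ρ 0 * ‖u' 0 0‖ ^ 2 = 1 / ρ 0 * ‖u 0 0‖ ^ 2 := by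
      rw [← hn]; field_simp
    have h2 : 1 / ρ 0 * ‖u 0 0‖ ^ 2 ≤ K * ‖u 0 0‖ ^ 2 := by
      gcongr; exact (hKj 0 (by omega)).2
    have h3 : K * ‖u 0 0‖ ^ 2 ≤ β * (K * ‖u 0 0‖ ^ 2) := by
      apply le_mul_of_one_le_left _ hβ; positivity
    simp only [he, Nat.cast_zero]
    rw [h1]; linarith
  have hfin : β * UT ≤ β * (P * (ε * UT + 1 / (4 * ε) * GT) + B * GT) := by
    have t1 : B * GT ≤ β * (B * GT) := by
      apply le_mul_of_one_le_left _ hβ; positivity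
    have t2 : B * e 0 ≤ B * (β * ((1 + K) * (ε * UT + 1 / (4 * ε) * GT))) := by
      have : 0 ≤ β := by linarith
      refine mul_le_mul_of_nonneg_left (he0b.trans ?_) hBpos.le
      gcongr
    calc _ ≤ _ := hUTb
      _ ≤ B * (β * ((1 + K) * (ε * UT + 1 / (4 * ε) * GT))) + β * (B * GT) := by linarith
      _ = _ := by rw [hP]; ring
  have hfin2 := le_of_mul_le_mul_left hfin (by linarith)
  have i1 : P * (ε * UT + 1 / (4 * ε) * GT) = UT / 2 + P ^ 2 / 2 * GT := by
    rw [hε]; field_simp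
    try ring
  rw [i1] at hfin2
  linarith
end
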